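/- arXiv:1403.3736 — 3 statements merged into one kernel-verified Lean document; each statement's English description precedes it below -/
import Mathlib

section
/- The linear span of the homomorphism densities t(H,−), as H ranges over finite simple graphs, is dense in the space of cut-norm continuous class functions on W under the topology of uniform convergence: for every class function F : W → ℝ continuous with respect to the cut norm and every ε > 0, there exist finitely many finite simple graphs H₁, …, H_m and reals c₁, …, c_m such that sup_{f ∈ W} |F(f) − Σ_{i=1}^m c_i·t(H_i, f)| < ε. -/
open MeasureTheory Filter Set Topology
open scoped BigOperators Classical ENNReal

noncomputable section

/-- The type of kernels: functions `[0,1]² → ℝ` (formalized as functions on all of `ℝ²`). -/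
abbrev Kern : Type := ℝ → ℝ → ℝ

/-- Lebesgue measure restricted to `[0,1]`. -/
abbrev μ01 : Measure ℝ := volume.restrict (Set.Icc 0 1)

/-- Symmetric measurable function. -/
def IsSymmMeas (f : Kern) : Prop :=
  Measurable (Function.uncurry f) ∧ ∀ x y, f x y = f y x

/-- Membership in the space `𝒲` of bounded symmetric measurable functions. -/
def IsKernel (f : Kern) : Prop := IsSymmMeas f ∧ ∃ C : ℝ, ∀ x y, |f x y| ≤ C

/-- A graphon: a symmetric measurable function with values in `[0,1]`. -/
def IsGraphon (f : Kern) : Prop := IsSymmMeas f ∧ ∀ x y, f x y ∈ Set.Icc (0:ℝ) 1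

/-- The set `W` of graphons. -/
def Graphons : Set Kern := {f | IsGraphon f}

/-- A multigraph (no loops, multiple edges allowed), with vertex set `Fin nv` and
edge (multi)set indexed by `Fin ne`, the edge `e` having endpoints `s e`, `t e`. -/
structure MG where
  nv : ℕ
  ne : ℕ
  s : Fin ne → Fin nv
  t : Fin ne → Fin nv
  noLoop : ∀ e, s e ≠ t e

/-- The homomorphism density `t(G, f)` of a multigraph `G` in a kernel `f`. -/
def homDensity (G : MG) (f : Kern) : ℝ :=
  ∫ x : Fin G.nv → ℝ, ∏ e : Fin G.ne, f (x (G.s e)) (x (G.t e))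
    ∂(Measure.pi fun _ => μ01)

/-- A node-and-edge homomorphism of multigraphs. -/
structure MGHom (G H : MG) where
  vMap : Fin G.nv → Fin H.nv
  eMap : Fin G.ne → Fin H.ne
  compat : ∀ e, ({H.s (eMap e), H.t (eMap e)} : Finset (Fin H.nv))
      = {vMap (G.s e), vMap (G.t e)}

/-- A surjective node-and-edge homomorphism. -/
def MGHom.Surj {G H : MG} (φ : MGHom G H) : Prop :=
  Function.Surjective φ.vMap ∧ Function.Surjective φ.eMap

/-- A bijective node-and-edge homomorphism. -/
def MGHom.Bij {G H : MG} (φ : MGHom G H) : Prop :=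
  Function.Bijective φ.vMap ∧ Function.Bijective φ.eMap

instance (G H : MG) : Finite (MGHom G H) := by
  have hinj : Function.Injective (fun φ : MGHom G H => (φ.vMap, φ.eMap)) := by
    rintro ⟨v1, e1, h1⟩ ⟨v2, e2, h2⟩ h
    simp only [Prod.mk.injEq] at h
    obtain ⟨hv, he⟩ := h
    subst hv; subst he; rfl
  exact Finite.of_injective _ hinj

/-- Isomorphism of multigraphs. -/
def MGIso (G H : MG) : Prop := ∃ φ : MGHom G H, φ.Bij

/-- A multigraph with no isolated vertices. -/
def NoIsolated (G : MG) : Prop := ∀ v, ∃ e, G.s e = v ∨ G.t e = v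

/-- A multigraph is simple if no two (distinct) edges have the same pair of endpoints. -/
def IsSimpleMG (G : MG) : Prop :=
  ∀ e e', ({G.s e, G.t e} : Finset (Fin G.nv)) = ({G.s e', G.t e'} : Finset (Fin G.nv))
    → e = e'

/-- A class function on graphon space: it only depends on the homomorphism densities
with respect to finite simple graphs. -/
def IsClassFun (F : Kern → ℝ) : Prop :=
  ∀ f g, IsGraphon f → IsGraphon g →
    (∀ G : MG, IsSimpleMG G → homDensity G f = homDensity G g) → F f = F g

/-- The `L¹` distance between two kernels (on the square `[0,1]²`). -/
def l1Dist (f g : Kern) : ℝ := ∫ x, ∫ y, |f x y - g x y| ∂μ01 ∂μ01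

/-- Continuity on the set of graphons with respect to the `L¹` norm. -/
def L1ContOn (F : Kern → ℝ) : Prop :=
  ∀ f ∈ Graphons, ∀ ε : ℝ, 0 < ε → ∃ δ : ℝ, 0 < δ ∧
    ∀ g ∈ Graphons, l1Dist f g < δ → |F f - F g| < ε

/-- The cut norm of a kernel. -/
def cutNorm (f : Kern) : ℝ :=
  sSup {r : ℝ | ∃ S T : Set ℝ, MeasurableSet S ∧ MeasurableSet T ∧
    S ⊆ Set.Icc 0 1 ∧ T ⊆ Set.Icc 0 1 ∧ r = |∫ x in S, ∫ y in T, f x y|}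

/-- Continuity on the set of graphons with respect to the cut norm. -/
def CutContOn (F : Kern → ℝ) : Prop :=
  ∀ f ∈ Graphons, ∀ ε : ℝ, 0 < ε → ∃ δ : ℝ, 0 < δ ∧
    ∀ g ∈ Graphons, cutNorm (f - g) < δ → |F f - F g| < ε

section Gateaux

variable {E : Type*} [AddCommGroup E] [Module ℝ E]

/-- Admissible directions at `f` for a convex subset `U` of a real vector space:
directions `g` so that `f + ε g ∈ U` for all sufficiently small `ε ∈ [0,1)`. -/
def adm (U : Set E) (f : E) : Set E :=
  {g | ∃ ε₀ : ℝ, 0 < ε₀ ∧ ε₀ ≤ 1 ∧ ∀ ε : ℝ, 0 ≤ ε → ε < ε₀ → f + ε • g ∈ U}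

/-- Iterated mixed Gâteaux derivative `d^n F(f; g₁, …, g_n)` of `F : U → ℝ`, computed
through one-sided difference quotients restricted to `U`; the derivative in the last
direction is taken first.  (The value is given by `Filter.limUnder`, i.e. it is the
limit of the difference quotients whenever this limit exists.) -/
def gD (U : Set E) (F : E → ℝ) : (n : ℕ) → E → (Fin n → E) → ℝ
  | 0 => fun f _ => F f
  | n + 1 => fun f g =>
      limUnder (nhdsWithin (0:ℝ) {t : ℝ | t ≠ 0 ∧ f + t • g (Fin.last n) ∈ U})
        (fun t => (gD U F n (f + t • g (Fin.last n)) (fun i => g i.castSucc)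
              - gD U F n f (fun i => g i.castSucc)) / t)

/-- `F` is `n` times Gâteaux differentiable on `U`: all iterated Gâteaux derivatives
up to order `n` in admissible directions exist (i.e. the corresponding difference
quotients genuinely converge). -/
def GDiffN (U : Set E) (F : E → ℝ) : ℕ → Prop
  | 0 => True
  | n + 1 => GDiffN U F n ∧
      ∀ f ∈ U, ∀ g : Fin (n+1) → E, (∀ i, g i ∈ adm U f) →
        Tendsto
          (fun t : ℝ => (gD U F n (f + t • g (Fin.last n)) (fun i => g i.castSucc)
              - gD U F n f (fun i => g i.castSucc)) / t)
          (nhdsWithin (0:ℝ) {t : ℝ | t ≠ 0 ∧ f + t • g (Fin.last n) ∈ U})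
          (nhds (gD U F (n+1) f g))

/-- `F : U → ℝ` is `C^n` at `f`: for any admissible directions `g₁, …, g_m`, the map
`(λ₁, …, λ_m) ↦ F(f + Σᵢ λᵢ gᵢ)` admits a `C^n` extension to all of `ℝ^m`. -/
def IsCnAt (U : Set E) (F : E → ℝ) (n : ℕ) (f : E) : Prop :=
  ∀ (m : ℕ) (g : Fin m → E), (∀ i, g i ∈ adm U f) →
    ∃ G : (Fin m → ℝ) → ℝ, ContDiff ℝ n G ∧
      ∀ lam : Fin m → ℝ, f + ∑ i, lam i • g i ∈ U → G lam = F (f + ∑ i, lam i • g i)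

/-- `F` is `C^n` (everywhere on `U`). -/
def IsCn (U : Set E) (F : E → ℝ) (n : ℕ) : Prop := ∀ f ∈ U, IsCnAt U F n f

/-- `F` is Gâteaux smooth: `C^n` at every point for every `n`. -/
def GSmooth (U : Set E) (F : E → ℝ) : Prop := ∀ n : ℕ, IsCn U F n

end Gateaux

/-- Iso-invariance of a family of constants indexed by multigraphs. -/
def IsoInvariant (a : MG → ℝ) : Prop := ∀ G H, MGIso G H → a G = a H

/-- Coefficients indexed by the isomorphism classes of multigraphs with at most `N`
edges and no isolated vertices (encoded as iso-invariant families of constants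
vanishing outside this class of multigraphs). -/
def GoodCoeffs (N : ℕ) (a : MG → ℝ) : Prop :=
  IsoInvariant a ∧ ∀ G : MG, ¬(G.ne ≤ N ∧ NoIsolated G) → a G = 0

/-- A functional on `W^n` is multilinear if its restriction to tuples from the
subspace `𝒲` (= span of `W`) is linear in each coordinate. -/
def MultilinearOnKerns (n : ℕ) (Λ : (Fin n → Kern) → ℝ) : Prop :=
  (∀ (g : Fin n → Kern), (∀ j, IsKernel (g j)) → ∀ (i : Fin n) (u v : Kern),
      IsKernel u → IsKernel v →
      Λ (Function.update g i (u + v))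
        = Λ (Function.update g i u) + Λ (Function.update g i v)) ∧
  (∀ (g : Fin n → Kern), (∀ j, IsKernel (g j)) → ∀ (i : Fin n) (c : ℝ) (u : Kern),
      IsKernel u →
      Λ (Function.update g i (c • u)) = c * Λ (Function.update g i u))

/-- A functional on `W^n` extends to a multilinear functional on `(span ℝ W)^n`. -/
def IsMultilinearOnW (n : ℕ) (Λ : (Fin n → Kern) → ℝ) : Prop :=
  ∃ L : MultilinearMap ℝ (fun _ : Fin n => ↥(Submodule.span ℝ Graphons)) ℝ,
    ∀ (g : Fin n → Kern) (h : ∀ i, g i ∈ Graphons),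
      L (fun i => ⟨g i, Submodule.subset_span (h i)⟩) = Λ g

/-- An invertible Lebesgue-measure-preserving bijection of `[0,1]`. -/
def IsMPB (σ : ℝ → ℝ) : Prop :=
  MeasurePreserving σ μ01 μ01 ∧ Set.BijOn σ (Set.Icc 0 1) (Set.Icc 0 1)

/-- The action `f ↦ f^σ` of maps of `[0,1]` on kernels. -/
def Kern.translate (σ : ℝ → ℝ) (f : Kern) : Kern := fun x y => f (σ x) (σ y)

/-- The cell `((a)/p, (a+1)/p]` of the regular partition of `[0,1]` (`a = 0, …, p-1`). -/
def cell (p : ℕ) (a : Fin p) : Set ℝ :=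
  Set.Ioc (((a : ℕ) : ℝ) / (p : ℝ)) ((((a : ℕ) : ℝ) + 1) / (p : ℝ))

/-- The basic step graphon `e^p_(a,b)`: symmetrized indicator of `cell a × cell b`. -/
def ep (p : ℕ) (a b : Fin p) : Kern := fun x y =>
  if (x ∈ cell p a ∧ y ∈ cell p b) ∨ (x ∈ cell p b ∧ y ∈ cell p a) then 1 else 0

/-- The step kernel with values `c a b` on the cell `cell a × cell b` (`a ≠ b`) and `0`
on the diagonal cells and outside `(0,1]²`. -/
def stepFn (p : ℕ) (c : Fin p → Fin p → ℝ) : Kern := fun x y =>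
  ∑ a : Fin p, ∑ b : Fin p, if a ≠ b ∧ x ∈ cell p a ∧ y ∈ cell p b then c a b else 0

/-- The set `W_𝐩 = ⋃ₚ W_p` of step graphons. -/
def StepGraphons : Set Kern := {f | IsGraphon f ∧ ∃ p c, f = stepFn p c}

/-- The union of the `S_[0,1]`-translates of `W_𝐩`. -/
def StepTranslates : Set Kern :=
  {f | ∃ σ : ℝ → ℝ, IsMPB σ ∧ ∃ g ∈ StepGraphons, f = Kern.translate σ g}

/-- Add `m` isolated vertices to a multigraph. -/
def MG.pad (G : MG) (m : ℕ) : MG where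
  nv := G.nv + m
  ne := G.ne
  s := fun e => Fin.castAdd m (G.s e)
  t := fun e => Fin.castAdd m (G.t e)
  noLoop := fun e h => G.noLoop e (by
    apply Fin.ext
    simpa using congrArg Fin.val h)

/-- Two multigraphs become isomorphic after deleting isolated vertices (equivalently,
after adding enough isolated vertices). -/
def StripEquiv (G H : MG) : Prop := ∃ a b : ℕ, MGIso (G.pad a) (H.pad b)

/-- A tuple of pairs of distinct indices in `Fin p` (encoding a tuple in `E_p^n`). -/
def ValidTuple (p n : ℕ) (x : Fin n → Fin p × Fin p) : Prop := ∀ l, (x l).1 ≠ (x l).2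

/-- The multigraph `Γ_{n,p}(x)` associated to a tuple `x ∈ E_p^n`. -/
def tupleMG (p n : ℕ) (x : Fin n → Fin p × Fin p) (hx : ValidTuple p n x) : MG :=
  ⟨p, n, fun l => (x l).1, fun l => (x l).2, hx⟩

/-- Symmetry of a functional on `W^n` under permutation of arguments. -/
def SymmFunc (n : ℕ) (Λ : (Fin n → Kern) → ℝ) : Prop :=
  ∀ (g : Fin n → Kern), (∀ i, g i ∈ Graphons) → ∀ τ : Equiv.Perm (Fin n),
    Λ (g ∘ τ) = Λ g

/-- `S_[0,1]`-invariance of a functional on `W^n`. -/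
def SInvFunc (n : ℕ) (Λ : (Fin n → Kern) → ℝ) : Prop :=
  ∀ (g : Fin n → Kern), (∀ i, g i ∈ Graphons) → ∀ σ : ℝ → ℝ, IsMPB σ →
    Λ (fun i => Kern.translate σ (g i)) = Λ g

/-- `π` is the consistency-constraint matrix `π_{n,k}`: it is invariant under
isomorphism-after-deleting-isolated-vertices in both arguments, and for every `p ≥ 2`,
every symmetric `S_[0,1]`-invariant multilinear functional `Λ : W^n → ℝ`, every
`x ∈ E_p^n` and every complete system `y` of pairwise non-isomorphic representatives
of the multigraphs with `n` edges on `kp` vertices, one has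
`C_{n,p}(Λ)(Γ(x)) = Σ_h π(Γ(x)∼, h∼) C_{n,kp}(Λ)(h)`. -/
def ConsistencyMatrix (n k : ℕ) (π : MG → MG → ℕ) : Prop :=
  (∀ G G' H H', StripEquiv G G' → StripEquiv H H' → π G H = π G' H') ∧
  ∀ p : ℕ, 2 ≤ p → ∀ Λ : (Fin n → Kern) → ℝ,
    SymmFunc n Λ → SInvFunc n Λ → MultilinearOnKerns n Λ →
    ∀ (x : Fin n → Fin p × Fin p) (hx : ValidTuple p n x),
    ∀ (m : ℕ) (y : Fin m → Fin n → Fin (k*p) × Fin (k*p))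
      (hy : ∀ i, ValidTuple (k*p) n (y i)),
      (∀ i j, i ≠ j →
        ¬ MGIso (tupleMG (k*p) n (y i) (hy i)) (tupleMG (k*p) n (y j) (hy j))) →
      (∀ (z : Fin n → Fin (k*p) × Fin (k*p)) (hz : ValidTuple (k*p) n z),
        ∃ i, MGIso (tupleMG (k*p) n z hz) (tupleMG (k*p) n (y i) (hy i))) →
      Λ (fun l => ep p (x l).1 (x l).2)
        = ∑ i : Fin m,
            (π (tupleMG p n x hx) (tupleMG (k*p) n (y i) (hy i)) : ℝ)
              * Λ (fun l => ep (k*p) (y i l).1 (y i l).2)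

/-- Adjacency relation of a multigraph. -/
def MG.adj (G : MG) (u v : Fin G.nv) : Prop :=
  ∃ e, (G.s e = u ∧ G.t e = v) ∨ (G.s e = v ∧ G.t e = u)

/-- The homomorphism density of the simplification `G^simp` of a multigraph `G`
(replace each family of parallel edges by a single edge). -/
def simpHomDensity (G : MG) (f : Kern) : ℝ :=
  ∫ x : Fin G.nv → ℝ,
    ∏ q ∈ Finset.univ.filter (fun q : Fin G.nv × Fin G.nv => q.1 < q.2 ∧ G.adj q.1 q.2),
      f (x q.1) (x q.2) ∂(Measure.pi fun _ => μ01)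

/-- Tensor product of two kernels with respect to a fixed measure-preserving map
`φ : [0,1] → [0,1]²`. -/
def tensProd (φ : ℝ → ℝ × ℝ) (f g : Kern) : Kern :=
  fun x y => f (φ x).1 (φ y).1 * g (φ x).2 (φ y).2

/-- `m`-fold tensor power of a kernel. -/
def tensPow (φ : ℝ → ℝ × ℝ) (f : Kern) : ℕ → Kern
  | 0 => fun _ _ => 1
  | 1 => f
  | (m+2) => tensProd φ f (tensPow φ f (m+1))

/-- A complete system of representatives for the isomorphism classes of multigraphs
with no isolated vertices. -/
def IsRepSet (R : Set MG) : Prop :=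
  (∀ G ∈ R, NoIsolated G) ∧ ∀ G : MG, NoIsolated G → ∃! H, H ∈ R ∧ MGIso G H

/-- A `k`-labelled multigraph: a multigraph together with an injective labelling of `k`
distinguished vertices. -/
structure LMG (k : ℕ) where
  G : MG
  lab : Fin k → Fin G.nv
  inj : Function.Injective lab

/-- No unlabelled isolated vertices. -/
def LMG.NoUnlabIsolated {k : ℕ} (H : LMG k) : Prop :=
  ∀ v, (∃ e, H.G.s e = v ∨ H.G.t e = v) ∨ ∃ a, H.lab a = v

/-- Assignment of coordinates to the vertices of a `k`-labelled multigraph: labelled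
vertices get the fixed values `x`, unlabelled ones the integration variables `y`. -/
def LMG.assign {k : ℕ} (H : LMG k) (x : Fin k → ℝ) (y : Fin H.G.nv → ℝ) :
    Fin H.G.nv → ℝ :=
  fun v => if h : ∃ a, H.lab a = v then x h.choose else y v

/-- The partially labelled homomorphism density `t_𝐱(H, f)`. -/
def lhom {k : ℕ} (H : LMG k) (x : Fin k → ℝ) (f : Kern) : ℝ :=
  ∫ y : Fin H.G.nv → ℝ,
    ∏ e : Fin H.G.ne, f (H.assign x y (H.G.s e)) (H.assign x y (H.G.t e))
    ∂(Measure.pi fun _ => μ01)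

/-- The weighted partially labelled homomorphism density `t_𝐱(H, f; w)`. -/
def wlhom {k : ℕ} (H : LMG k) (x : Fin k → ℝ) (f : Kern)
    (w : (Fin H.G.nv → ℝ) → ℝ) : ℝ :=
  ∫ y : Fin H.G.nv → ℝ,
    w (H.assign x y) *
      ∏ e : Fin H.G.ne, f (H.assign x y (H.G.s e)) (H.assign x y (H.G.t e))
    ∂(Measure.pi fun _ => μ01)

/-- The seminorm `‖w‖_{1,𝐱} = t_𝐱(H, 1, |w|)` of a weight. -/
def wnorm {k : ℕ} (H : LMG k) (x : Fin k → ℝ) (w : (Fin H.G.nv → ℝ) → ℝ) : ℝ :=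
  ∫ y : Fin H.G.nv → ℝ, |w (H.assign x y)| ∂(Measure.pi fun _ => μ01)

/-- Label-respecting isomorphism of `k`-labelled multigraphs. -/
def LMGIso {k : ℕ} (H H' : LMG k) : Prop :=
  ∃ (φv : Fin H.G.nv ≃ Fin H'.G.nv) (φe : Fin H.G.ne ≃ Fin H'.G.ne),
    (∀ e, ({H'.G.s (φe e), H'.G.t (φe e)} : Finset (Fin H'.G.nv))
        = {φv (H.G.s e), φv (H.G.t e)}) ∧
    ∀ a, φv (H.lab a) = H'.lab a

/-- A complete system of representatives for the label-respecting isomorphism classes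
of `k`-labelled multigraphs with no unlabelled isolated vertices. -/
def IsLRepSet (k : ℕ) (R : Set (LMG k)) : Prop :=
  (∀ H ∈ R, H.NoUnlabIsolated) ∧
  ∀ H : LMG k, H.NoUnlabIsolated → ∃! H', H' ∈ R ∧ LMGIso H H'

end



instance isProb_mu01 : IsProbabilityMeasure μ01 := by
  constructor
  simp [μ01]

lemma mp_projIcc : MeasurePreserving (Set.projIcc (0:ℝ) 1 zero_le_one) μ01
    (volume : Measure unitInterval) := by
  refine ⟨(continuous_projIcc).measurable, ?_⟩
  have h : MeasurePreserving (Subtype.val : unitInterval → ℝ) volume μ01 :=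
    MeasureTheory.measurePreserving_subtype_coe measurableSet_Icc
  rw [← h.map_eq, Measure.map_map continuous_projIcc.measurable measurable_subtype_coe]
  have : (Set.projIcc (0:ℝ) 1 zero_le_one) ∘ (Subtype.val : unitInterval → ℝ) = id := by
    funext x; simp
  rw [this, Measure.map_id]

open ProbabilityTheory in
lemma transfer {Ω Z B : Type*} [MeasurableSpace Ω] [MeasurableSpace Z] [MeasurableSpace B]
    [StandardBorelSpace B] [Nonempty B] (P : Measure Ω) [IsProbabilityMeasure P]
    (X : Ω → Z) (Y : Ω → B) (hX : Measurable X) (hY : Measurable Y) :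
    ∃ h : Z × ℝ → B, Measurable h ∧
      MeasurePreserving (fun p : Z × ℝ => (p.1, h p)) ((P.map X).prod μ01)
        (P.map (fun ω => (X ω, Y ω))) := by
  obtain ⟨f, hf, hfe⟩ := Kernel.exists_measurable_map_eq_unitInterval (condDistrib Y X P)
  have hp := mp_projIcc
  have hm : Measurable (fun p : Z × ℝ => f p.1 (Set.projIcc (0:ℝ) 1 zero_le_one p.2)) :=
    hf.comp (measurable_fst.prodMk (hp.measurable.comp measurable_snd))
  refine ⟨fun p => f p.1 (Set.projIcc (0:ℝ) 1 zero_le_one p.2), hm,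
    measurable_fst.prodMk hm, ?_⟩
  rw [← compProd_map_condDistrib (X := X) hY.aemeasurable]
  have : IsProbabilityMeasure (P.map X) := Measure.isProbabilityMeasure_map hX.aemeasurable
  ext s hs
  rw [Measure.map_apply (measurable_fst.prodMk hm) hs, Measure.compProd_apply hs,
    Measure.prod_apply ((measurable_fst.prodMk hm) hs)]
  congr 1
  funext z
  have hfz : Measurable (f z) := hf.comp measurable_prodMk_left
  rw [← hfe z, Measure.map_apply hfz (measurable_prodMk_left hs), ← hp.map_eq,
    Measure.map_apply hp.measurable (hfz (measurable_prodMk_left hs))]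
  rfl

lemma glue {A Z B : Type*} [MeasurableSpace A] [MeasurableSpace Z] [MeasurableSpace B]
    [StandardBorelSpace B] [Nonempty B] [StandardBorelSpace Z]
    (P : Measure A) [IsProbabilityMeasure P] (Q : Measure B) [IsProbabilityMeasure Q]
    (z : A → Z) (z' : B → Z) (hz : Measurable z) (hz' : Measurable z')
    (h : P.map z = Q.map z') :
    ∃ β : A × ℝ → B, MeasurePreserving β (P.prod μ01) Q ∧
      ∀ᵐ p ∂(P.prod μ01), z' (β p) = z p.1 := by
  obtain ⟨g, hg, hgm⟩ := transfer Q z' id hz' measurable_id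
  rw [← h] at hgm
  have h1 : MeasurePreserving (fun p : A × ℝ => (z p.1, p.2)) (P.prod μ01)
      ((P.map z).prod μ01) := by
    have : IsProbabilityMeasure (P.map z) := Measure.isProbabilityMeasure_map hz.aemeasurable
    exact (MeasurePreserving.mk hz rfl).prod (MeasurePreserving.id μ01)
  have h2 := hgm.comp h1
  refine ⟨fun p => g (z p.1, p.2), ⟨hg.comp h1.measurable, ?_⟩, ?_⟩
  · have h3 : MeasurePreserving (Prod.snd : Z × B → B) (Q.map (fun ω => (z' ω, id ω))) Q := by
      refine ⟨measurable_snd, ?_⟩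
      rw [Measure.map_map measurable_snd (hz'.prodMk measurable_id)]
      exact Measure.map_id
    exact (h3.comp h2).map_eq
  · have h4 : ∀ᵐ q ∂(Q.map (fun ω => (z' ω, id ω))), z' q.2 = q.1 := by
      rw [ae_map_iff (hz'.prodMk measurable_id).aemeasurable]
      · simp
      · exact measurableSet_eq_fun (hz'.comp measurable_snd) measurable_fst
    exact h2.quasiMeasurePreserving.ae h4

lemma exists_mp {B : Type*} [MeasurableSpace B]
    [StandardBorelSpace B] [Nonempty B] (Q : Measure B) [IsProbabilityMeasure Q] :
    ∃ θ : ℝ → B, MeasurePreserving θ μ01 Q := by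
  obtain ⟨f, hf, hfe⟩ := Measure.exists_measurable_map_eq Q
  exact ⟨_, (MeasurePreserving.mk hf hfe).comp mp_projIcc⟩

lemma push_density {α β : Type*} [MeasurableSpace α] [MeasurableSpace β]
    (μ : Measure α) (ν : Measure β) [IsProbabilityMeasure μ] [IsProbabilityMeasure ν]
    (θ : β → α) (hθ : MeasurePreserving θ ν μ) (u : β → ℝ) (hu : Measurable u)
    (hu1 : ∀ x, u x ∈ Icc (0:ℝ) 1) :
    ∃ w : α → ℝ, Measurable w ∧ (∀ x, w x ∈ Icc (0:ℝ) 1) ∧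
      ∀ φ : α → ℝ, Measurable φ → ∫ y, φ (θ y) * u y ∂ν = ∫ x, φ x * w x ∂μ := by
  set m0 := ν.withDensity (fun y => ENNReal.ofReal (u y)) with hm0
  have hm0le : m0 ≤ ν := by
    calc m0 ≤ ν.withDensity 1 := by
          apply withDensity_mono
          filter_upwards with y
          simpa using (hu1 y).2
      _ = ν := withDensity_one
  set m := m0.map θ with hm
  have hmle : m ≤ μ := by
    rw [← hθ.map_eq]; exact Measure.map_mono hm0le hθ.measurable
  have : IsFiniteMeasure m := isFiniteMeasure_of_le μ hmle
  have hac : m ≪ μ := Measure.absolutelyContinuous_of_le hmle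
  refine ⟨fun x => (min (m.rnDeriv μ x) 1).toReal,
    ((Measure.measurable_rnDeriv m μ).min measurable_const).ennreal_toReal, ?_, ?_⟩
  · intro x
    refine ⟨ENNReal.toReal_nonneg, ?_⟩
    have : (min (m.rnDeriv μ x) 1).toReal ≤ (1:ℝ≥0∞).toReal :=
      ENNReal.toReal_mono (by simp) (min_le_right _ _)
    simpa using this
  · intro φ hφ
    have e1 : ∫ x, φ x ∂m = ∫ x, φ x * (min (m.rnDeriv μ x) 1).toReal ∂μ := by
      rw [← integral_rnDeriv_smul hac]
      apply integral_congr_ae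
      filter_upwards [Measure.rnDeriv_le_one_of_le hmle] with x hx
      have hx' : m.rnDeriv μ x ≤ (1:ℝ≥0∞) := hx
      rw [min_eq_left hx', smul_eq_mul, mul_comm]
    rw [← e1, hm, integral_map hθ.measurable.aemeasurable hφ.aestronglyMeasurable, hm0,
      integral_withDensity_eq_integral_toReal_smul (by fun_prop) (by simp)]
    apply integral_congr_ae
    filter_upwards with y
    rw [ENNReal.toReal_ofReal (hu1 y).1, smul_eq_mul, mul_comm]


/-- Cut norm at most `r`, tested against `[0,1]`-valued functions. -/
def CutLE {α : Type*} [MeasurableSpace α] (μ : Measure α) (h : α → α → ℝ) (r : ℝ) : Prop :=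
  ∀ u v : α → ℝ, Measurable u → Measurable v → (∀ x, u x ∈ Icc (0:ℝ) 1) →
    (∀ x, v x ∈ Icc (0:ℝ) 1) → |∫ p, h p.1 p.2 * u p.1 * v p.2 ∂(μ.prod μ)| ≤ r

/-- Bounded measurable two-variable functions. -/
def BM {α : Type*} [MeasurableSpace α] (h : α → α → ℝ) : Prop :=
  Measurable (Function.uncurry h) ∧ ∃ C : ℝ, ∀ x y, |h x y| ≤ C

section
variable {α β : Type*} [MeasurableSpace α] [MeasurableSpace β]

lemma integrable_of_bdd {μ : Measure α} [IsFiniteMeasure μ] {f : α → ℝ} (hf : Measurable f)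
    {C : ℝ} (hC : ∀ x, |f x| ≤ C) : Integrable f μ :=
  Integrable.of_bound hf.aestronglyMeasurable C (by filter_upwards with x; simpa using hC x)

lemma BM.add {h k : α → α → ℝ} (hh : BM h) (hk : BM k) : BM (fun x y => h x y + k x y) := by
  obtain ⟨m1, C, hC⟩ := hh
  obtain ⟨m2, D, hD⟩ := hk
  exact ⟨m1.add m2, C + D, fun x y => (abs_add_le _ _).trans (add_le_add (hC x y) (hD x y))⟩

lemma BM.neg {h : α → α → ℝ} (hh : BM h) : BM (fun x y => - h x y) := by
  obtain ⟨m1, C, hC⟩ := hh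
  exact ⟨m1.neg, C, fun x y => by rw [abs_neg]; exact hC x y⟩

lemma BM.sub {h k : α → α → ℝ} (hh : BM h) (hk : BM k) : BM (fun x y => h x y - k x y) := by
  simpa [sub_eq_add_neg] using hh.add hk.neg

lemma BM.comp {h : α → α → ℝ} (hh : BM h) {θ : β → α} (hθ : Measurable θ) :
    BM (fun x y => h (θ x) (θ y)) := by
  obtain ⟨m1, C, hC⟩ := hh
  exact ⟨m1.comp ((hθ.comp measurable_fst).prodMk (hθ.comp measurable_snd)), C,
    fun x y => hC _ _⟩

lemma meas_test {h : α → α → ℝ} (hh : BM h) {u v : α → ℝ} (hu : Measurable u)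
    (hv : Measurable v) : Measurable (fun p : α × α => h p.1 p.2 * u p.1 * v p.2) := by
  have h1 : Measurable (fun p : α × α => h p.1 p.2) := hh.1
  fun_prop

lemma integrable_test {μ : Measure (α × α)} [IsFiniteMeasure μ] {h : α → α → ℝ} (hh : BM h)
    {u v : α → ℝ} (hu : Measurable u) (hv : Measurable v)
    {A : ℝ} (hu1 : ∀ x, |u x| ≤ A) (hv1 : ∀ x, |v x| ≤ A) :
    Integrable (fun p : α × α => h p.1 p.2 * u p.1 * v p.2) μ := by
  have hm := meas_test hh hu hv
  obtain ⟨m1, C, hC⟩ := hh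
  refine integrable_of_bdd hm (C := C * A * A) fun p => ?_
  rw [abs_mul, abs_mul]
  have h0 := hC p.1 p.2
  have h1 := hu1 p.1
  have h2 := hv1 p.2
  have a0 := abs_nonneg (h p.1 p.2)
  have a1 := abs_nonneg (u p.1)
  have c0 := a0.trans h0
  have c1 := a1.trans h1
  exact mul_le_mul (mul_le_mul h0 h1 a1 c0) h2 (abs_nonneg _) (mul_nonneg c0 c1)

lemma abs_le_one_of_mem {x : ℝ} (h : x ∈ Icc (0:ℝ) 1) : |x| ≤ 1 :=
  abs_le.2 ⟨by linarith [h.1], h.2⟩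

lemma CutLE.add {μ : Measure α} [IsProbabilityMeasure μ] {h k : α → α → ℝ} (hh : BM h)
    (hk : BM k) {r s : ℝ} (h1 : CutLE μ h r) (h2 : CutLE μ k s) :
    CutLE μ (fun x y => h x y + k x y) (r + s) := by
  intro u v hu hv hu1 hv1
  have i1 := integrable_test (μ := μ.prod μ) hh hu hv (fun x => abs_le_one_of_mem (hu1 x))
    (fun x => abs_le_one_of_mem (hv1 x))
  have i2 := integrable_test (μ := μ.prod μ) hk hu hv (fun x => abs_le_one_of_mem (hu1 x))
    (fun x => abs_le_one_of_mem (hv1 x))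
  simp only [add_mul]
  rw [integral_add i1 i2]
  exact (abs_add_le _ _).trans (add_le_add (h1 u v hu hv hu1 hv1) (h2 u v hu hv hu1 hv1))

lemma CutLE.neg {μ : Measure α} {h : α → α → ℝ} {r : ℝ} (h1 : CutLE μ h r) :
    CutLE μ (fun x y => - h x y) r := by
  intro u v hu hv hu1 hv1
  simp only [neg_mul]
  rw [integral_neg, abs_neg]
  exact h1 u v hu hv hu1 hv1

lemma CutLE.congr_ae {μ : Measure α} {h k : α → α → ℝ} {r : ℝ} (h1 : CutLE μ h r)
    (e : ∀ᵐ p ∂(μ.prod μ), h p.1 p.2 = k p.1 p.2) : CutLE μ k r := by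
  intro u v hu hv hu1 hv1
  have : ∫ p, k p.1 p.2 * u p.1 * v p.2 ∂(μ.prod μ) =
      ∫ p, h p.1 p.2 * u p.1 * v p.2 ∂(μ.prod μ) := by
    apply integral_congr_ae
    filter_upwards [e] with p hp
    rw [hp]
  rw [this]
  exact h1 u v hu hv hu1 hv1

lemma CutLE.mono {μ : Measure α} {h : α → α → ℝ} {r s : ℝ} (h1 : CutLE μ h r) (hrs : r ≤ s) :
    CutLE μ h s := fun u v hu hv hu1 hv1 => (h1 u v hu hv hu1 hv1).trans hrs

lemma CutLE.of_l1 {μ : Measure α} [IsProbabilityMeasure μ] {h : α → α → ℝ} (hh : BM h) {r : ℝ}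
    (h1 : ∫ p, |h p.1 p.2| ∂(μ.prod μ) ≤ r) : CutLE μ h r := by
  intro u v hu hv hu1 hv1
  refine (abs_integral_le_integral_abs).trans (le_trans ?_ h1)
  have hm : Measurable (fun p : α × α => h p.1 p.2) := hh.1
  obtain ⟨C, hC⟩ := hh.2
  refine integral_mono_of_nonneg (by filter_upwards with p; positivity)
    (integrable_of_bdd (by fun_prop) (C := C) (fun p => by simpa using hC p.1 p.2)) ?_
  filter_upwards with p
  rw [abs_mul, abs_mul]
  have a1 := abs_le_one_of_mem (hu1 p.1)
  have a2 := abs_le_one_of_mem (hv1 p.2)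
  calc |h p.1 p.2| * |u p.1| * |v p.2| ≤ |h p.1 p.2| * 1 * 1 := by gcongr
    _ = _ := by ring

lemma CutLE.pull {μ : Measure α} {ν : Measure β} [IsProbabilityMeasure μ]
    [IsProbabilityMeasure ν] {h : α → α → ℝ} (hh : BM h) {r : ℝ} (h1 : CutLE μ h r)
    {θ : β → α} (hθ : MeasurePreserving θ ν μ) : CutLE ν (fun x y => h (θ x) (θ y)) r := by
  intro u v hu hv hu1 hv1
  obtain ⟨u', hu', hu1', eu⟩ := push_density μ ν θ hθ u hu hu1
  obtain ⟨v', hv', hv1', ev⟩ := push_density μ ν θ hθ v hv hv1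
  have key : ∫ p, h (θ p.1) (θ p.2) * u p.1 * v p.2 ∂(ν.prod ν) =
      ∫ p, h p.1 p.2 * u' p.1 * v' p.2 ∂(μ.prod μ) := by
    rw [integral_prod _ (integrable_test (hh.comp hθ.measurable) hu hv
      (fun x => abs_le_one_of_mem (hu1 x)) (fun x => abs_le_one_of_mem (hv1 x))),
      integral_prod _ (integrable_test hh hu' hv'
      (fun x => abs_le_one_of_mem (hu1' x)) (fun x => abs_le_one_of_mem (hv1' x)))]
    have hm : Measurable (fun p : α × α => h p.1 p.2) := hh.1
    have e1 : ∀ x, ∫ y, h (θ x) (θ y) * u x * v y ∂ν =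
        (fun x' => ∫ y, h x' y * v' y ∂μ) (θ x) * u x := by
      intro x
      have hmx : Measurable (fun y => h (θ x) y) := hm.comp measurable_prodMk_left
      simp only []
      rw [← ev _ hmx, ← integral_mul_const]
      congr 1; funext y; ring
    have e2 : ∀ x, ∫ y, h x y * u' x * v' y ∂μ =
        (∫ y, h x y * v' y ∂μ) * u' x := by
      intro x
      rw [← integral_mul_const]
      congr 1; funext y; ring
    simp only [e1, e2]
    refine eu (fun x' => ∫ y, h x' y * v' y ∂μ) ?_
    have : StronglyMeasurable (fun p : α × α => h p.1 p.2 * v' p.2) := by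
      apply Measurable.stronglyMeasurable; fun_prop
    exact this.integral_prod_right'.measurable
  rw [key]
  exact h1 u' v' hu' hv' hu1' hv1'

end

lemma IsGraphon.bm {f : Kern} (hf : IsGraphon f) : BM f :=
  ⟨hf.1.1, 1, fun x y => abs_le_one_of_mem (hf.2 x y)⟩

lemma IsGraphon.comp {f : Kern} (hf : IsGraphon f) {X : ℝ → ℝ} (hX : Measurable X) :
    IsGraphon (fun x y => f (X x) (X y)) :=
  ⟨⟨(hf.bm.comp hX).1, fun _ _ => hf.1.2 _ _⟩, fun _ _ => hf.2 _ _⟩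

/-- `f` and `g` can be coupled at cut distance at most `r`. -/
def DLE (f g : Kern) (r : ℝ) : Prop :=
  ∃ (Ω : Type) (_ : MeasurableSpace Ω) (_ : StandardBorelSpace Ω) (P : Measure Ω)
    (_ : IsProbabilityMeasure P) (X Y : Ω → ℝ), MeasurePreserving X P μ01 ∧
    MeasurePreserving Y P μ01 ∧ CutLE P (fun a b => f (X a) (X b) - g (Y a) (Y b)) r

lemma DLE.nonneg {f g : Kern} {r : ℝ} (h : DLE f g r) : 0 ≤ r := by
  obtain ⟨Ω, _, _, P, _, X, Y, hX, hY, h⟩ := h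
  have := h (fun _ => 0) (fun _ => 0) measurable_const measurable_const (by simp) (by simp)
  exact (abs_nonneg _).trans this

lemma DLE.symm {f g : Kern} {r : ℝ} (h : DLE f g r) : DLE g f r := by
  obtain ⟨Ω, i1, i2, P, i3, X, Y, hX, hY, h⟩ := h
  refine ⟨Ω, i1, i2, P, i3, Y, X, hY, hX, ?_⟩
  simpa using h.neg

lemma DLE.refl (f : Kern) : DLE f f 0 := by
  refine ⟨ℝ, inferInstance, inferInstance, μ01, inferInstance, id, id, MeasurePreserving.id _,
    MeasurePreserving.id _, ?_⟩
  intro u v _ _ _ _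
  simp

lemma DLE.one {f g : Kern} (hf : IsGraphon f) (hg : IsGraphon g) : DLE f g 1 := by
  refine ⟨ℝ, inferInstance, inferInstance, μ01, inferInstance, id, id, MeasurePreserving.id _,
    MeasurePreserving.id _, ?_⟩
  apply CutLE.of_l1 (hf.bm.sub hg.bm)
  have hb : ∀ p : ℝ × ℝ, |f p.1 p.2 - g p.1 p.2| ≤ 1 := fun p => by
    have h1 := hf.2 p.1 p.2
    have h2 := hg.2 p.1 p.2
    exact abs_le.2 ⟨by linarith [h1.1, h2.2], by linarith [h1.2, h2.1]⟩
  have := integral_mono_of_nonneg (μ := μ01.prod μ01) (f := fun p => |f p.1 p.2 - g p.1 p.2|)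
    (g := fun _ => (1:ℝ)) (by filter_upwards with p; positivity) (integrable_const _)
    (by filter_upwards with p; exact hb p)
  simpa using this

lemma DLE.trans {f g k : Kern} (hf : IsGraphon f) (hg : IsGraphon g) (hk : IsGraphon k)
    {r s : ℝ} (h1 : DLE f g r) (h2 : DLE g k s) : DLE f k (r + s) := by
  obtain ⟨Ω, i1, i2, P, i3, X, Y, hX, hY, h⟩ := h1
  obtain ⟨Ω', j1, j2, Q, j3, Y', Z, hY', hZ, h'⟩ := h2
  have : Nonempty Ω' := Q.nonempty_of_neZero
  obtain ⟨b, hb, hbe⟩ := glue P Q Y Y' hY.measurable hY'.measurable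
    (by rw [hY.map_eq, hY'.map_eq])
  have hfst : MeasurePreserving (Prod.fst : Ω × ℝ → Ω) (P.prod μ01) P := measurePreserving_fst
  refine ⟨Ω × ℝ, inferInstance, inferInstance, P.prod μ01, inferInstance, X ∘ Prod.fst, Z ∘ b,
    hX.comp hfst, hZ.comp hb, ?_⟩
  have c1 := h.pull ((hf.bm.comp hX.measurable).sub (hg.bm.comp hY.measurable)) hfst
  have c2 := h'.pull ((hg.bm.comp hY'.measurable).sub (hk.bm.comp hZ.measurable)) hb
  have c3 := c1.add (((hf.bm.comp hX.measurable).sub (hg.bm.comp hY.measurable)).comp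
    hfst.measurable) (((hg.bm.comp hY'.measurable).sub (hk.bm.comp hZ.measurable)).comp
    hb.measurable) c2
  refine c3.congr_ae ?_
  have m1 : MeasurePreserving (Prod.fst : (Ω × ℝ) × (Ω × ℝ) → (Ω × ℝ))
    ((P.prod μ01).prod (P.prod μ01)) (P.prod μ01) := measurePreserving_fst
  have m2 : MeasurePreserving (Prod.snd : (Ω × ℝ) × (Ω × ℝ) → (Ω × ℝ))
    ((P.prod μ01).prod (P.prod μ01)) (P.prod μ01) := measurePreserving_snd
  filter_upwards [m1.quasiMeasurePreserving.ae hbe, m2.quasiMeasurePreserving.ae hbe] with p e1 e2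
  simp only [Function.comp, e1, e2]
  ring

/-- The type of graphons. -/
def GraphonT : Type := {f : Kern // IsGraphon f}

noncomputable instance : PseudoMetricSpace GraphonT where
  dist f g := sInf {r : ℝ | DLE f.1 g.1 r}
  dist_self f := by
    apply le_antisymm
    · exact csInf_le ⟨0, fun r hr => hr.nonneg⟩ (DLE.refl _)
    · exact Real.sInf_nonneg fun r hr => hr.nonneg
  dist_comm f g := by
    congr 1; ext r; exact ⟨DLE.symm, DLE.symm⟩
  dist_triangle f g k := by
    have hb : ∀ f g : GraphonT, BddBelow {r : ℝ | DLE f.1 g.1 r} :=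
      fun f g => ⟨0, fun r hr => hr.nonneg⟩
    have hn : ∀ f g : GraphonT, {r : ℝ | DLE f.1 g.1 r}.Nonempty :=
      fun f g => ⟨1, DLE.one f.2 g.2⟩
    apply le_of_forall_pos_lt_add
    intro ε hε
    obtain ⟨r, hr, hr'⟩ := Real.lt_sInf_add_pos (hn f g) (half_pos hε)
    obtain ⟨s, hs, hs'⟩ := Real.lt_sInf_add_pos (hn g k) (half_pos hε)
    have := csInf_le (hb f k) (DLE.trans f.2 g.2 k.2 hr hs)
    linarith

lemma dist_le_of_DLE {f g : GraphonT} {r : ℝ} (h : DLE f.1 g.1 r) : dist f g ≤ r :=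
  csInf_le ⟨0, fun r hr => hr.nonneg⟩ h

lemma DLE_of_dist_lt {f g : GraphonT} {r : ℝ} (h : dist f g < r) : DLE f.1 g.1 r := by
  obtain ⟨s, hs, hs'⟩ := exists_lt_of_csInf_lt ⟨1, DLE.one f.2 g.2⟩ h
  obtain ⟨Ω, i1, i2, P, i3, X, Y, hX, hY, h⟩ := hs
  exact ⟨Ω, i1, i2, P, i3, X, Y, hX, hY, h.mono hs'.le⟩


section
variable {Ω : Type*} [MeasurableSpace Ω] {P : Measure Ω} [IsProbabilityMeasure P]

lemma mp_update {n : ℕ} (i : Fin n) :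
    MeasurePreserving (fun p : (Fin n → Ω) × Ω => Function.update p.1 i p.2)
      ((Measure.pi fun _ => P).prod P) (Measure.pi fun _ => P) := by
  have hm : Measurable (fun p : (Fin n → Ω) × Ω => Function.update p.1 i p.2) := by
    rw [measurable_pi_iff]
    intro j
    by_cases h : j = i
    · subst h; simpa using measurable_snd
    · simp only [Function.update_of_ne h]; fun_prop
  refine ⟨hm, ?_⟩
  symm
  apply Measure.pi_eq
  intro s hs
  rw [Measure.map_apply hm (MeasurableSet.univ_pi hs)]
  have : (fun p : (Fin n → Ω) × Ω => Function.update p.1 i p.2) ⁻¹' (Set.univ.pi s) =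
      (Set.univ.pi (Function.update s i Set.univ)) ×ˢ (s i) := by
    ext p
    simp only [Set.mem_preimage, Set.mem_pi, Set.mem_univ, true_imp_iff, Set.mem_prod]
    constructor
    · intro h
      refine ⟨fun j => ?_, by simpa using h i⟩
      by_cases hj : j = i
      · subst hj; simp
      · simpa [Function.update_of_ne hj] using h j
    · rintro ⟨h, h'⟩ j
      by_cases hj : j = i
      · subst hj; simpa using h'
      · simpa [Function.update_of_ne hj] using h j
  rw [this, Measure.prod_prod, Measure.pi_pi, ← Finset.mul_prod_erase Finset.univ _
    (Finset.mem_univ i), ← Finset.mul_prod_erase Finset.univ (fun j => P (s j))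
    (Finset.mem_univ i)]
  simp only [Function.update_self, measure_univ, one_mul]
  rw [mul_comm]
  congr 1
  apply Finset.prod_congr rfl
  intro j hj
  rw [Function.update_of_ne (Finset.ne_of_mem_erase hj)]

lemma mp_update2 {n : ℕ} (i j : Fin n) :
    MeasurePreserving (fun p : (Fin n → Ω) × (Ω × Ω) =>
      Function.update (Function.update p.1 i p.2.1) j p.2.2)
      ((Measure.pi fun _ => P).prod (P.prod P)) (Measure.pi fun _ => P) := by
  have h1 := (mp_update (P := P) i).prod (MeasurePreserving.id P)
  have h2 := (mp_update (P := P) j).comp h1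
  have h3 := (measurePreserving_prodAssoc (Measure.pi fun _ : Fin n => P) P P).symm
  exact h2.comp h3

/-- Homomorphism density with a separate kernel for every edge. -/
noncomputable def tW (G : MG) (P : Measure Ω) (W : Fin G.ne → Ω → Ω → ℝ) : ℝ :=
  ∫ x : Fin G.nv → Ω, ∏ e, W e (x (G.s e)) (x (G.t e)) ∂(Measure.pi fun _ => P)

lemma meas_edge {n : ℕ} {K : Ω → Ω → ℝ} (hK : Measurable (Function.uncurry K)) (i j : Fin n) :
    Measurable (fun x : Fin n → Ω => K (x i) (x j)) :=
  hK.comp (g := Function.uncurry K) (f := fun x : Fin n → Ω => (x i, x j))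
    ((measurable_pi_apply i).prodMk (measurable_pi_apply j))

lemma prod_mem_Icc {ι : Type*} (S : Finset ι) (f : ι → ℝ) (h : ∀ i, f i ∈ Icc (0:ℝ) 1) :
    ∏ i ∈ S, f i ∈ Icc (0:ℝ) 1 :=
  ⟨Finset.prod_nonneg fun i _ => (h i).1, Finset.prod_le_one (fun i _ => (h i).1)
    (fun i _ => (h i).2)⟩

lemma one_edge (G : MG) (hG : IsSimpleMG G) (W W' : Fin G.ne → Ω → Ω → ℝ)
    (hW : ∀ e, Measurable (Function.uncurry (W e))) (hW1 : ∀ e x y, W e x y ∈ Icc (0:ℝ) 1)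
    (hW' : ∀ e, Measurable (Function.uncurry (W' e))) (hW1' : ∀ e x y, W' e x y ∈ Icc (0:ℝ) 1)
    (e0 : Fin G.ne) (he : ∀ e, e ≠ e0 → W e = W' e) {r : ℝ}
    (hr : CutLE P (fun a b => W e0 a b - W' e0 a b) r) :
    |tW G P W - tW G P W'| ≤ r := by
  have hIntegr : ∀ V : Fin G.ne → Ω → Ω → ℝ, (∀ e, Measurable (Function.uncurry (V e))) →
      (∀ e x y, V e x y ∈ Icc (0:ℝ) 1) →
      Integrable (fun x : Fin G.nv → Ω => ∏ e, V e (x (G.s e)) (x (G.t e)))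
        (Measure.pi fun _ => P) := by
    intro V hV hV1
    refine integrable_of_bdd (C := 1) ?_ ?_
    · exact Finset.measurable_prod _ fun e _ => meas_edge (hV e) _ _
    · intro x
      exact abs_le_one_of_mem (prod_mem_Icc _ _ fun e => hV1 e _ _)
  set s := G.s e0 with hs
  set t := G.t e0 with ht
  have hst : s ≠ t := G.noLoop e0
  set A : Finset (Fin G.ne) := (Finset.univ.erase e0).filter (fun e => G.s e ≠ t ∧ G.t e ≠ t)
    with hA
  set B : Finset (Fin G.ne) := (Finset.univ.erase e0).filter
    (fun e => ¬ (G.s e ≠ t ∧ G.t e ≠ t)) with hB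
  set u : (Fin G.nv → Ω) → Ω → ℝ := fun x a =>
    ∏ e ∈ A, W e (Function.update x s a (G.s e)) (Function.update x s a (G.t e)) with hu
  set v : (Fin G.nv → Ω) → Ω → ℝ := fun x b =>
    ∏ e ∈ B, W e (Function.update x t b (G.s e)) (Function.update x t b (G.t e)) with hv
  have hBs : ∀ e ∈ B, G.s e ≠ s ∧ G.t e ≠ s := by
    intro e heB
    simp only [hB, Finset.mem_filter, Finset.mem_erase, Finset.mem_univ, and_true] at heB
    obtain ⟨hne, htt⟩ := heB
    have hnl := G.noLoop e
    constructor
    · intro h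
      have h2 : G.t e = t := by
        by_contra h3
        exact htt ⟨by rw [h]; exact hst, h3⟩
      apply hne
      apply hG
      rw [h, h2]
    · intro h
      have h2 : G.s e = t := by
        by_contra h3
        exact htt ⟨h3, by rw [h]; exact hst⟩
      apply hne
      apply hG
      rw [h, h2, Finset.pair_comm]
  have hcurry : ∀ (i : Fin G.nv), Measurable (fun p : (Fin G.nv → Ω) × Ω =>
      Function.update p.1 i p.2) := fun i => (mp_update (P := P) i).measurable
  have hmu : ∀ x, Measurable (u x) := by
    intro x
    refine Finset.measurable_prod _ fun e _ => ?_
    exact (meas_edge (hW e) _ _).comp ((hcurry s).comp measurable_prodMk_left)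
  have hmv : ∀ x, Measurable (v x) := by
    intro x
    refine Finset.measurable_prod _ fun e _ => ?_
    exact (meas_edge (hW e) _ _).comp ((hcurry t).comp measurable_prodMk_left)
  have hu1 : ∀ x a, u x a ∈ Icc (0:ℝ) 1 := fun x a => prod_mem_Icc _ _ fun e => hW1 e _ _
  have hv1 : ∀ x a, v x a ∈ Icc (0:ℝ) 1 := fun x a => prod_mem_Icc _ _ fun e => hW1 e _ _
  set Dk : (Fin G.nv → Ω) → ℝ := fun x => (∏ e, W e (x (G.s e)) (x (G.t e))) -
    ∏ e, W' e (x (G.s e)) (x (G.t e)) with hDk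
  have hDm : Measurable Dk :=
    (Finset.measurable_prod _ fun e _ => meas_edge (hW e) _ _).sub
    (Finset.measurable_prod _ fun e _ => meas_edge (hW' e) _ _)
  have hDb : ∀ x, |Dk x| ≤ 1 := by
    intro x
    have a1 := prod_mem_Icc Finset.univ (fun e => W e (x (G.s e)) (x (G.t e)))
      (fun e => hW1 e _ _)
    have a2 := prod_mem_Icc Finset.univ (fun e => W' e (x (G.s e)) (x (G.t e)))
      (fun e => hW1' e _ _)
    exact abs_le.2 ⟨by simp only [hDk]; linarith [a1.1, a2.2],
      by simp only [hDk]; linarith [a1.2, a2.1]⟩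
  have hfac : ∀ x a b, Dk (Function.update (Function.update x s a) t b) =
      (W e0 a b - W' e0 a b) * u x a * v x b := by
    intro x a b
    simp only [hDk]
    rw [← Finset.mul_prod_erase Finset.univ _ (Finset.mem_univ e0),
      ← Finset.mul_prod_erase Finset.univ (fun e => W' e _ _) (Finset.mem_univ e0)]
    have e1 : ∀ V : Fin G.ne → Ω → Ω → ℝ, V e0
        (Function.update (Function.update x s a) t b (G.s e0))
        (Function.update (Function.update x s a) t b (G.t e0)) = V e0 a b := by
      intro V
      rw [← hs, ← ht, Function.update_self, Function.update_of_ne hst, Function.update_self]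
    rw [e1 W, e1 W']
    have e2 : ∏ e ∈ Finset.univ.erase e0, W' e
        (Function.update (Function.update x s a) t b (G.s e))
        (Function.update (Function.update x s a) t b (G.t e)) =
        ∏ e ∈ Finset.univ.erase e0, W e
        (Function.update (Function.update x s a) t b (G.s e))
        (Function.update (Function.update x s a) t b (G.t e)) := by
      apply Finset.prod_congr rfl
      intro e hee
      rw [he e (Finset.ne_of_mem_erase hee)]
    rw [e2, ← sub_mul, mul_assoc]
    congr 1
    rw [← Finset.prod_filter_mul_prod_filter_not (Finset.univ.erase e0)
      (fun e => G.s e ≠ t ∧ G.t e ≠ t)]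
    congr 1
    · apply Finset.prod_congr rfl
      intro e heA
      have := (Finset.mem_filter.1 heA).2
      rw [Function.update_of_ne this.1, Function.update_of_ne this.2]
    · apply Finset.prod_congr rfl
      intro e heB
      have := hBs e heB
      rw [Function.update_comm hst, Function.update_of_ne this.1, Function.update_of_ne this.2]
  have h0 : tW G P W - tW G P W' = ∫ x, Dk x ∂(Measure.pi fun _ => P) := by
    rw [tW, tW, ← integral_sub (hIntegr W hW hW1) (hIntegr W' hW' hW1')]
  have hmp := mp_update2 (P := P) s t
  rw [h0, ← hmp.map_eq, integral_map hmp.measurable.aemeasurable hDm.aestronglyMeasurable,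
    integral_prod (fun p : (Fin G.nv → Ω) × (Ω × Ω) =>
      Dk (Function.update (Function.update p.1 s p.2.1) t p.2.2))
      (integrable_of_bdd (hDm.comp hmp.measurable) (C := 1) fun p => hDb _)]
  have hb : ∀ x, |∫ q : Ω × Ω, Dk (Function.update (Function.update x s q.1) t q.2)
      ∂(P.prod P)| ≤ r := by
    intro x
    simp only [hfac]
    exact hr (u x) (v x) (hmu x) (hmv x) (hu1 x) (hv1 x)
  have := norm_integral_le_of_norm_le_const (μ := Measure.pi fun _ : Fin G.nv => P)
    (f := fun x => ∫ q : Ω × Ω, Dk (Function.update (Function.update x s q.1) t q.2)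
      ∂(P.prod P)) (C := r) (by filter_upwards with x; exact hb x)
  simpa using this

lemma counting (G : MG) (hG : IsSimpleMG G) (K L : Ω → Ω → ℝ)
    (hK : Measurable (Function.uncurry K)) (hK1 : ∀ x y, K x y ∈ Icc (0:ℝ) 1)
    (hL : Measurable (Function.uncurry L)) (hL1 : ∀ x y, L x y ∈ Icc (0:ℝ) 1)
    {r : ℝ} (hr : CutLE P (fun a b => K a b - L a b) r) :
    |tW G P (fun _ => K) - tW G P (fun _ => L)| ≤ G.ne * r := by
  have key : ∀ S : Finset (Fin G.ne),
      |tW G P (fun e => if e ∈ S then K else L) - tW G P (fun _ => L)| ≤ S.card * r := by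
    intro S
    induction S using Finset.induction with
    | empty => simp
    | insert e0 S he0 ih =>
      have h1 := one_edge (P := P) G hG (fun e => if e ∈ insert e0 S then K else L)
        (fun e => if e ∈ S then K else L)
        (fun e => by split_ifs <;> assumption)
        (fun e x y => by split_ifs <;> simp only [hK1, hL1])
        (fun e => by split_ifs <;> assumption)
        (fun e x y => by split_ifs <;> simp only [hK1, hL1])
        e0 (fun e hne => by simp [Finset.mem_insert, hne]) (r := r)
        (by simpa [he0] using hr)
      rw [Finset.card_insert_of_notMem he0]
      push_cast
      have := abs_sub_le (tW G P (fun e => if e ∈ insert e0 S then K else L))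
        (tW G P (fun e => if e ∈ S then K else L)) (tW G P (fun _ => L))
      linarith
  simpa using key Finset.univ

lemma homDensity_pull (G : MG) {f : Kern} (hf : Measurable (Function.uncurry f)) {X : Ω → ℝ}
    (hX : MeasurePreserving X P μ01) :
    homDensity G f = tW G P (fun _ a b => f (X a) (X b)) := by
  have hmp := measurePreserving_pi (fun _ : Fin G.nv => P) (fun _ => μ01) (fun _ => hX)
  rw [homDensity, tW, ← hmp.map_eq, integral_map hmp.measurable.aemeasurable]
  exact (Finset.measurable_prod _ fun e _ => meas_edge hf _ _).aestronglyMeasurable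

end

lemma homDensity_dist (G : MG) (hG : IsSimpleMG G) (f g : GraphonT) :
    |homDensity G f.1 - homDensity G g.1| ≤ G.ne * dist f g := by
  have h : ∀ r, dist f g < r → |homDensity G f.1 - homDensity G g.1| ≤ G.ne * r := by
    intro r hr
    obtain ⟨Ω, i1, i2, P, i3, X, Y, hX, hY, h⟩ := DLE_of_dist_lt hr
    rw [homDensity_pull G f.2.1.1 hX, homDensity_pull G g.2.1.1 hY]
    exact counting G hG _ _ (f.2.bm.comp hX.measurable).1 (fun x y => f.2.2 _ _)
      (g.2.bm.comp hY.measurable).1 (fun x y => g.2.2 _ _) h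
  have hc : Tendsto (fun r : ℝ => (G.ne : ℝ) * r) (𝓝[>] (dist f g)) (𝓝 (G.ne * dist f g)) :=
    ((continuous_const.mul continuous_id).tendsto _).mono_left nhdsWithin_le_nhds
  refine ge_of_tendsto hc ?_
  filter_upwards [self_mem_nhdsWithin] with r hr
  exact h r hr

lemma homDensity_cont (G : MG) (hG : IsSimpleMG G) :
    Continuous (fun f : GraphonT => homDensity G f.1) := by
  have : LipschitzWith (G.ne : NNReal) (fun f : GraphonT => homDensity G f.1) := by
    apply LipschitzWith.of_dist_le_mul
    intro f g
    simpa [Real.dist_eq] using homDensity_dist G hG f g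
  exact this.continuous

lemma homDensity_comp (G : MG) {f : Kern} (hf : IsGraphon f) {X : ℝ → ℝ}
    (hX : MeasurePreserving X μ01 μ01) :
    homDensity G (fun x y => f (X x) (X y)) = homDensity G f :=
  (homDensity_pull G hf.1.1 hX).symm

lemma cutNorm_le {f g : Kern} (hf : IsGraphon f) (hg : IsGraphon g) {r : ℝ}
    (h : CutLE μ01 (fun x y => f x y - g x y) r) : cutNorm (f - g) ≤ r := by
  have hr0 : 0 ≤ r := by
    have := h (fun _ => 0) (fun _ => 0) measurable_const measurable_const (by simp) (by simp)
    exact (abs_nonneg _).trans this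
  apply Real.sSup_le _ hr0
  rintro _ ⟨S, T, hS, hT, hS1, hT1, rfl⟩
  have hind : ∀ A : Set ℝ, ∀ x, A.indicator (fun _ => (1:ℝ)) x ∈ Icc (0:ℝ) 1 := by
    intro A x
    by_cases hx : x ∈ A <;> simp [hx]
  have h1 := h (S.indicator fun _ => 1) (T.indicator fun _ => 1)
    (measurable_const.indicator hS) (measurable_const.indicator hT) (hind S) (hind T)
  rw [integral_prod _ (integrable_test (hf.bm.sub hg.bm) (measurable_const.indicator hS)
    (measurable_const.indicator hT) (fun x => abs_le_one_of_mem (hind S x))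
    (fun x => abs_le_one_of_mem (hind T x)))] at h1
  have hres : ∀ A : Set ℝ, MeasurableSet A → A ⊆ Icc 0 1 → ∀ φ : ℝ → ℝ,
      ∫ x in A, φ x = ∫ x, A.indicator φ x ∂μ01 := by
    intro A hA hA1 φ
    rw [integral_indicator hA, Measure.restrict_restrict hA, inter_eq_left.2 hA1]
  have e : ∫ x in S, ∫ y in T, (f - g) x y = ∫ x, ∫ y, (f x y - g x y) *
      S.indicator (fun _ => 1) x * T.indicator (fun _ => 1) y ∂μ01 ∂μ01 := by
    rw [hres S hS hS1]
    congr 1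
    funext x
    by_cases hx : x ∈ S
    · rw [indicator_of_mem hx, hres T hT hT1]
      congr 1
      funext y
      by_cases hy : y ∈ T <;> simp [hx, hy]
    · simp [hx]
  rw [e]
  exact h1


lemma CutLE.push {α β : Type*} [MeasurableSpace α] [MeasurableSpace β]
    {μ : Measure α} {ν : Measure β} [IsProbabilityMeasure μ]
    [IsProbabilityMeasure ν] {h : α → α → ℝ} (hh : BM h) {r : ℝ}
    {θ : β → α} (hθ : MeasurePreserving θ ν μ) (h1 : CutLE ν (fun x y => h (θ x) (θ y)) r) :
    CutLE μ h r := by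
  intro u v hu hv hu1 hv1
  have := h1 (u ∘ θ) (v ∘ θ) (hu.comp hθ.measurable) (hv.comp hθ.measurable)
    (fun x => hu1 _) (fun x => hv1 _)
  have hp := hθ.prod hθ
  rw [← hp.map_eq, integral_map hp.measurable.aemeasurable
    (meas_test hh hu hv).aestronglyMeasurable]
  exact this

lemma DLE.step {f g : Kern} (hf : IsGraphon f) (hg : IsGraphon g) {r : ℝ} (h : DLE f g r) :
    ∃ k : ℝ × ℝ → ℝ, MeasurePreserving k (μ01.prod μ01) μ01 ∧
      CutLE (μ01.prod μ01) (fun p q => f p.1 q.1 - g (k p) (k q)) r := by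
  obtain ⟨Ω, i1, i2, P, i3, X, Y, hX, hY, h⟩ := h
  obtain ⟨k, hk, hkm⟩ := transfer P X Y hX.measurable hY.measurable
  rw [hX.map_eq] at hkm
  have hmXY : Measurable (fun ω => (X ω, Y ω)) := hX.measurable.prodMk hY.measurable
  have hXY : MeasurePreserving (fun ω => (X ω, Y ω)) P (P.map (fun ω => (X ω, Y ω))) :=
    ⟨hmXY, rfl⟩
  have : IsProbabilityMeasure (P.map (fun ω => (X ω, Y ω))) :=
    Measure.isProbabilityMeasure_map hmXY.aemeasurable
  have hbm : BM (fun a b : ℝ × ℝ => f a.1 b.1 - g a.2 b.2) :=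
    (hf.bm.comp measurable_fst).sub (hg.bm.comp measurable_snd)
  refine ⟨k, ⟨hk, ?_⟩, ?_⟩
  · have h3 : MeasurePreserving (Prod.snd : ℝ × ℝ → ℝ) (P.map (fun ω => (X ω, Y ω))) μ01 := by
      refine ⟨measurable_snd, ?_⟩
      rw [Measure.map_map measurable_snd hmXY]
      exact hY.map_eq
    exact (h3.comp hkm).map_eq
  · exact (CutLE.push hbm hXY h).pull hbm hkm

lemma F_cont (F : Kern → ℝ) (hclass : IsClassFun F) (hcont : CutContOn F) :
    Continuous (fun f : GraphonT => F f.1) := by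
  obtain ⟨θ, hθ⟩ := exists_mp (μ01.prod μ01)
  rw [Metric.continuous_iff]
  intro f ε hε
  have hX : MeasurePreserving (Prod.fst ∘ θ) μ01 μ01 := measurePreserving_fst.comp hθ
  obtain ⟨δ, hδ, H⟩ := hcont _ (f.2.comp hX.measurable) ε hε
  refine ⟨δ / 2, by positivity, fun g hg => ?_⟩
  rw [dist_comm] at hg
  obtain ⟨k, hk, hc⟩ := (DLE_of_dist_lt hg).step f.2 g.2
  have hY : MeasurePreserving (k ∘ θ) μ01 μ01 := hk.comp hθ
  have hc' := hc.pull ((f.2.bm.comp measurable_fst).sub (g.2.bm.comp hk.measurable)) hθ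
  have h1 := H _ (g.2.comp hY.measurable) (lt_of_le_of_lt (cutNorm_le
    (f.2.comp hX.measurable) (g.2.comp hY.measurable) hc') (by linarith))
  have e1 : F f.1 = F (fun x y => f.1 ((Prod.fst ∘ θ) x) ((Prod.fst ∘ θ) y)) :=
    hclass _ _ f.2 (f.2.comp hX.measurable) fun G _ => (homDensity_comp G f.2 hX).symm
  have e2 : F g.1 = F (fun x y => g.1 ((k ∘ θ) x) ((k ∘ θ) y)) :=
    hclass _ _ g.2 (g.2.comp hY.measurable) fun G _ => (homDensity_comp G g.2 hY).symm
  rw [Real.dist_eq, abs_sub_comm, e1, e2]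
  exact h1

lemma weak_limit_aux {α : Type*} [MeasurableSpace α] (ν : Measure α) [IsProbabilityMeasure ν]
    (G : ℕ → α → ℝ) (hG : ∀ n, Measurable (G n)) (hG1 : ∀ n x, G n x ∈ Icc (0:ℝ) 1) :
    ∃ g : α → ℝ, Measurable g ∧ (∀ᵐ x ∂ν, g x ∈ Icc (0:ℝ) 1) ∧
      ∀ φ : α → ℝ, Measurable φ → (∃ C, ∀ x, |φ x| ≤ C) →
        Tendsto (fun n => ∫ x, G n x * φ x ∂ν) (hyperfilter ℕ : Filter ℕ)
          (𝓝 (∫ x, g x * φ x ∂ν)) := by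
  have hmem : ∀ φ : α → ℝ, Measurable φ → (∃ C, ∀ x, |φ x| ≤ C) → MemLp φ 2 ν := by
    rintro φ hφ ⟨C, hC⟩
    exact MemLp.of_bound hφ.aestronglyMeasurable C (by filter_upwards with x; exact hC x)
  have hGm : ∀ n, MemLp (G n) 2 ν := fun n =>
    hmem _ (hG n) ⟨1, fun x => abs_le_one_of_mem (hG1 n x)⟩
  set L : ℕ → Lp ℝ 2 ν := fun n => (hGm n).toLp (G n) with hL
  have hnorm : ∀ n, ‖L n‖ ≤ 1 := by
    intro n
    have := Lp.norm_le_of_ae_bound (f := L n) (C := 1) (by norm_num) (by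
      filter_upwards [(hGm n).coeFn_toLp] with x hx
      rw [hx]; exact abs_le_one_of_mem (hG1 n x))
    have h1 : measureUnivNNReal ν = 1 := by
      ext; simp [measureUnivNNReal]
    simpa [h1] using this
  set D : ℕ → WeakDual ℝ (Lp ℝ 2 ν) := fun n =>
    StrongDual.toWeakDual (InnerProductSpace.toDual ℝ (Lp ℝ 2 ν) (L n)) with hD
  have hK := WeakDual.isCompact_closedBall (0 : StrongDual ℝ (Lp ℝ 2 ν)) 1
  have hDK : ∀ n, D n ∈ (WeakDual.toStrongDual ⁻¹' Metric.closedBall (0 : StrongDual ℝ (Lp ℝ 2 ν)) 1) := by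
    intro n
    simp only [mem_preimage, mem_closedBall_zero_iff]
    have : ‖(InnerProductSpace.toDual ℝ (Lp ℝ 2 ν) (L n))‖ ≤ 1 := by
      rw [LinearIsometryEquiv.norm_map]; exact hnorm n
    exact this
  obtain ⟨ℓ, -, hℓ⟩ := hK.ultrafilter_le_nhds' ((hyperfilter ℕ).map D)
    (by
      rw [Ultrafilter.mem_map]
      filter_upwards with n
      exact hDK n)
  have hℓ' : Tendsto D (hyperfilter ℕ : Filter ℕ) (𝓝 ℓ) := hℓ
  set g0 : Lp ℝ 2 ν := (InnerProductSpace.toDual ℝ (Lp ℝ 2 ν)).symm (WeakDual.toStrongDual ℓ)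
    with hg0
  have hlim : ∀ φ : α → ℝ, Measurable φ → (∃ C, ∀ x, |φ x| ≤ C) →
      Tendsto (fun n => ∫ x, G n x * φ x ∂ν) (hyperfilter ℕ : Filter ℕ)
          (𝓝 (∫ x, g0 x * φ x ∂ν)) := by
    intro φ hφ hC
    have hφm := hmem φ hφ hC
    have h1 : Tendsto (fun n => D n (hφm.toLp φ)) (hyperfilter ℕ : Filter ℕ)
        (𝓝 (ℓ (hφm.toLp φ))) := ((WeakDual.eval_continuous (hφm.toLp φ)).tendsto _).comp hℓ'
    have e1 : ∀ n, D n (hφm.toLp φ) = ∫ x, G n x * φ x ∂ν := by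
      intro n
      change inner ℝ (L n) (hφm.toLp φ) = _
      rw [L2.inner_def]
      apply integral_congr_ae
      filter_upwards [(hGm n).coeFn_toLp, hφm.coeFn_toLp] with x hx hx'
      rw [hx, hx']
      simp [mul_comm]
    have e2 : ℓ (hφm.toLp φ) = ∫ x, g0 x * φ x ∂ν := by
      have : inner ℝ g0 (hφm.toLp φ) = ℓ (hφm.toLp φ) := by
        rw [hg0, InnerProductSpace.toDual_symm_apply]; rfl
      rw [← this, L2.inner_def]
      apply integral_congr_ae
      filter_upwards [hφm.coeFn_toLp] with x hx'
      rw [hx']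
      simp [mul_comm]
    rw [e2] at h1
    simpa only [e1] using h1
  have hg0i : Integrable g0 ν := (Lp.memLp g0).integrable (by norm_num)
  have hind : ∀ s : Set α, MeasurableSet s → ∀ k : α → ℝ,
      ∫ x, k x * s.indicator (fun _ => (1:ℝ)) x ∂ν = ∫ x in s, k x ∂ν := by
    intro s hs k
    rw [← integral_indicator hs]
    congr 1
    funext x
    by_cases hx : x ∈ s <;> simp [hx]
  have hlims : ∀ s : Set α, MeasurableSet s → Tendsto (fun n => ∫ x in s, G n x ∂ν)
      (hyperfilter ℕ : Filter ℕ) (𝓝 (∫ x in s, g0 x ∂ν)) := by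
    intro s hs
    have := hlim (s.indicator fun _ => 1) (measurable_const.indicator hs)
      ⟨1, fun x => by by_cases hx : x ∈ s <;> simp [hx]⟩
    simpa only [hind s hs] using this
  refine ⟨g0, (Lp.stronglyMeasurable g0).measurable, ?_, hlim⟩
  have h0 : 0 ≤ᵐ[ν] g0 := by
    apply ae_nonneg_of_forall_setIntegral_nonneg hg0i
    intro s hs _
    refine ge_of_tendsto' (hlims s hs) fun n => ?_
    exact integral_nonneg fun x => (hG1 n x).1
  have h1 : g0 ≤ᵐ[ν] fun _ => (1:ℝ) := by
    apply ae_le_of_forall_setIntegral_le hg0i (integrable_const _)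
    intro s hs _
    refine le_of_tendsto' (hlims s hs) fun n => ?_
    exact integral_mono ((hGm n).integrable (by norm_num)).integrableOn (integrable_const _)
      fun x => (hG1 n x).2
  filter_upwards [h0, h1] with x hx hx'
  exact ⟨hx, hx'⟩

lemma weak_limit (G : ℕ → Kern) (hG : ∀ n, IsGraphon (G n)) :
    ∃ g : Kern, IsGraphon g ∧ ∀ u v : ℝ → ℝ, Measurable u → Measurable v →
      (∀ x, u x ∈ Icc (0:ℝ) 1) → (∀ x, v x ∈ Icc (0:ℝ) 1) →
      Tendsto (fun n => ∫ p, G n p.1 p.2 * u p.1 * v p.2 ∂(μ01.prod μ01))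
        (hyperfilter ℕ : Filter ℕ) (𝓝 (∫ p, g p.1 p.2 * u p.1 * v p.2 ∂(μ01.prod μ01))) := by
  obtain ⟨g0, hg0, hg01, hlim⟩ := weak_limit_aux (μ01.prod μ01) (fun n p => G n p.1 p.2)
    (fun n => (hG n).1.1) (fun n p => (hG n).2 _ _)
  set g : Kern := fun x y => max 0 (min 1 ((g0 (x, y) + g0 (y, x)) / 2)) with hg
  have hgm : IsGraphon g := by
    refine ⟨⟨?_, fun x y => ?_⟩, fun x y => ?_⟩
    · have : Measurable (fun p : ℝ × ℝ => max 0 (min 1 ((g0 (p.1, p.2) + g0 (p.2, p.1)) / 2))) := by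
        fun_prop
      exact this
    · simp only [hg]; rw [add_comm]
    · simp [hg]
  refine ⟨g, hgm, fun u v hu hv hu1 hv1 => ?_⟩
  have hb : ∀ u v : ℝ → ℝ, (∀ x, u x ∈ Icc (0:ℝ) 1) → (∀ x, v x ∈ Icc (0:ℝ) 1) →
      ∀ p : ℝ × ℝ, |u p.1 * v p.2| ≤ 1 := fun u v hu1 hv1 p => by
    rw [abs_mul]
    exact mul_le_one₀ (abs_le_one_of_mem (hu1 _)) (abs_nonneg _) (abs_le_one_of_mem (hv1 _))
  have l1 := hlim (fun p => u p.1 * v p.2) (by fun_prop) ⟨1, hb u v hu1 hv1⟩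
  have l2 := hlim (fun p => v p.1 * u p.2) (by fun_prop) ⟨1, hb v u hv1 hu1⟩
  have l3 := (l1.add l2).div_const 2
  have hswap : MeasurePreserving (Prod.swap : ℝ × ℝ → ℝ × ℝ) (μ01.prod μ01) (μ01.prod μ01) :=
    Measure.measurePreserving_swap
  have hg01' := hswap.quasiMeasurePreserving.ae hg01
  have hIntegr : ∀ u v : ℝ → ℝ, Measurable u → Measurable v → (∀ x, u x ∈ Icc (0:ℝ) 1) →
      (∀ x, v x ∈ Icc (0:ℝ) 1) →
      Integrable (fun p : ℝ × ℝ => g0 p * (u p.1 * v p.2)) (μ01.prod μ01) := by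
    intro u v hu hv hu1 hv1
    refine Integrable.of_bound (by fun_prop) 1 ?_
    filter_upwards [hg01] with p hp
    rw [Real.norm_eq_abs, abs_mul]
    exact mul_le_one₀ (abs_le_one_of_mem hp) (abs_nonneg _) (hb u v hu1 hv1 p)
  have e : ∫ p, g p.1 p.2 * u p.1 * v p.2 ∂(μ01.prod μ01) =
      ((∫ p, g0 p * (u p.1 * v p.2) ∂(μ01.prod μ01)) +
        ∫ p, g0 p * (v p.1 * u p.2) ∂(μ01.prod μ01)) / 2 := by
    have hsw : Integrable (fun z : ℝ × ℝ => g0 z.swap * (v z.swap.1 * u z.swap.2))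
        (μ01.prod μ01) := (hIntegr v u hv hu hv1 hu1).swap
    rw [← integral_prod_swap (fun p : ℝ × ℝ => g0 p * (v p.1 * u p.2)),
      ← integral_add (hIntegr u v hu hv hu1 hv1) hsw, ← integral_div]
    apply integral_congr_ae
    filter_upwards [hg01, hg01'] with p hp hp'
    have hq : (g0 (p.1, p.2) + g0 (p.2, p.1)) / 2 ∈ Icc (0:ℝ) 1 := by
      have a1 : g0 (p.1, p.2) ∈ Icc (0:ℝ) 1 := hp
      have a2 : g0 (p.2, p.1) ∈ Icc (0:ℝ) 1 := hp'
      exact ⟨by linarith [a1.1, a2.1], by linarith [a1.2, a2.2]⟩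
    simp only [hg]
    rw [min_eq_right hq.2, max_eq_right hq.1]
    simp only [Prod.swap, Prod.fst, Prod.snd]
    ring
  rw [e]
  refine l3.congr fun n => ?_
  have e2 : ∫ p : ℝ × ℝ, G n p.1 p.2 * (v p.1 * u p.2) ∂(μ01.prod μ01) =
      ∫ p : ℝ × ℝ, G n p.1 p.2 * (u p.1 * v p.2) ∂(μ01.prod μ01) := by
    rw [← integral_prod_swap]
    congr 1
    funext p
    simp only [Prod.fst_swap, Prod.snd_swap]
    rw [(hG n).1.2 p.2 p.1]
    ring
  rw [e2]
  simp only [mul_assoc]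
  ring

/-- Successive gluing of couplings, on one fixed source of randomness. -/
noncomputable def St (θ : ℝ → ℝ × ℝ) (k : ℕ → ℝ × ℝ → ℝ) : ℕ → ℝ → ℝ × ℝ
  | 0 => θ
  | n + 1 => fun x => (k n ((St θ k n x).1, (θ (St θ k n x).2).1), (θ (St θ k n x).2).2)

lemma St_aux (θ : ℝ → ℝ × ℝ) (hθ : MeasurePreserving θ μ01 (μ01.prod μ01))
    (S : ℝ → ℝ × ℝ) (hS : MeasurePreserving S μ01 (μ01.prod μ01)) :
    MeasurePreserving (fun x => (((S x).1, (θ (S x).2).1), (θ (S x).2).2)) μ01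
      ((μ01.prod μ01).prod μ01) := by
  have h1 := ((MeasurePreserving.id μ01).prod hθ).comp hS
  exact (measurePreserving_prodAssoc μ01 μ01 μ01).symm.comp h1

lemma St_mp (θ : ℝ → ℝ × ℝ) (hθ : MeasurePreserving θ μ01 (μ01.prod μ01))
    (k : ℕ → ℝ × ℝ → ℝ) (hk : ∀ n, MeasurePreserving (k n) (μ01.prod μ01) μ01) (n : ℕ) :
    MeasurePreserving (St θ k n) μ01 (μ01.prod μ01) := by
  induction n with
  | zero => exact hθ
  | succ n ih => exact ((hk n).prod (MeasurePreserving.id μ01)).comp (St_aux θ hθ _ ih)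

instance : CompleteSpace GraphonT := by
  refine Metric.complete_of_convergent_controlled_sequences (fun n => (1/2:ℝ) ^ n)
    (by intro n; positivity) fun w hw => ?_
  have h1 : ∀ n, DLE (w n).1 (w (n+1)).1 ((1/2:ℝ) ^ n) := fun n =>
    DLE_of_dist_lt (hw n n (n+1) le_rfl (by omega))
  choose k hk hc using fun n => (h1 n).step (w n).2 (w (n+1)).2
  obtain ⟨θ, hθ⟩ := exists_mp (μ01.prod μ01)
  have hS := St_mp θ hθ k hk
  set X : ℕ → ℝ → ℝ := fun n => Prod.fst ∘ St θ k n with hX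
  have hXm : ∀ n, MeasurePreserving (X n) μ01 μ01 := fun n =>
    measurePreserving_fst.comp (hS n)
  set g : ℕ → Kern := fun n x y => (w n).1 (X n x) (X n y) with hg
  have hgG : ∀ n, IsGraphon (g n) := fun n => (w n).2.comp (hXm n).measurable
  have hstep : ∀ n, CutLE μ01 (fun x y => g n x y - g (n+1) x y) ((1/2:ℝ) ^ n) := by
    intro n
    have hm : MeasurePreserving (fun x => ((St θ k n x).1, (θ (St θ k n x).2).1)) μ01
        (μ01.prod μ01) :=
      (measurePreserving_fst (μ := μ01.prod μ01) (ν := μ01)).comp (St_aux θ hθ _ (hS n))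
    exact (hc n).pull (((w n).2.bm.comp measurable_fst).sub
      ((w (n+1)).2.bm.comp (hk n).measurable)) hm
  have hcau : ∀ n j, CutLE μ01 (fun x y => g n x y - g (n+j) x y)
      (2 * (1/2:ℝ) ^ n - 2 * (1/2:ℝ) ^ (n + j)) := by
    intro n j
    induction j with
    | zero =>
      intro u v _ _ _ _
      simp
    | succ j ih =>
      have := ih.add ((hgG n).bm.sub (hgG (n+j)).bm) ((hgG (n+j)).bm.sub (hgG (n+j+1)).bm)
        (hstep (n+j))
      have h2 : CutLE μ01 (fun x y => g n x y - g (n+(j+1)) x y)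
          (2 * (1/2:ℝ) ^ n - 2 * (1/2:ℝ) ^ (n + j) + (1/2:ℝ) ^ (n + j)) := by
        refine this.congr_ae ?_
        filter_upwards with p
        simp [add_assoc]
      refine h2.mono (le_of_eq ?_)
      rw [← add_assoc n j 1, pow_succ]
      ring
  obtain ⟨G, hG, hlim⟩ := weak_limit g hgG
  have hfin : ∀ n, CutLE μ01 (fun x y => g n x y - G x y) (2 * (1/2:ℝ) ^ n) := by
    intro n u v hu hv hu1 hv1
    have hI : ∀ K : Kern, IsGraphon K → Integrable (fun p : ℝ × ℝ => K p.1 p.2 * u p.1 * v p.2)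
        (μ01.prod μ01) := fun K hK => integrable_test hK.bm hu hv
        (fun x => abs_le_one_of_mem (hu1 x)) (fun x => abs_le_one_of_mem (hv1 x))
    have hsub : ∀ K K' : Kern, IsGraphon K → IsGraphon K' →
        ∫ p, (K p.1 p.2 - K' p.1 p.2) * u p.1 * v p.2 ∂(μ01.prod μ01) =
        (∫ p, K p.1 p.2 * u p.1 * v p.2 ∂(μ01.prod μ01)) -
        ∫ p, K' p.1 p.2 * u p.1 * v p.2 ∂(μ01.prod μ01) := by
      intro K K' hK hK'
      rw [← integral_sub (hI K hK) (hI K' hK')]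
      simp only [sub_mul]
    have l := ((tendsto_const_nhds (x := ∫ p, g n p.1 p.2 * u p.1 * v p.2
      ∂(μ01.prod μ01))).sub (hlim u v hu hv hu1 hv1)).abs
    rw [hsub _ _ (hgG n) hG]
    refine le_of_tendsto l ?_
    have hev : ∀ᶠ m in (hyperfilter ℕ : Filter ℕ), n ≤ m := by
      have := (eventually_ge_atTop n)
      rw [← Nat.cofinite_eq_atTop] at this
      exact hyperfilter_le_cofinite this
    filter_upwards [hev] with m hm
    obtain ⟨j, rfl⟩ := Nat.exists_eq_add_of_le hm
    rw [← hsub _ _ (hgG n) (hgG _)]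
    have hp : (0:ℝ) ≤ 2 * (1/2) ^ (n+j) := by positivity
    exact ((hcau n j) u v hu hv hu1 hv1).trans (by linarith)
  let Gt : GraphonT := ⟨G, hG⟩
  refine ⟨Gt, tendsto_iff_dist_tendsto_zero.2 ?_⟩
  have hz : Tendsto (fun n => 2 * (1/2:ℝ) ^ n) atTop (𝓝 0) := by
    simpa using (tendsto_pow_atTop_nhds_zero_of_lt_one (r := (1/2:ℝ)) (by norm_num)
      (by norm_num)).const_mul 2
  refine squeeze_zero (fun n => dist_nonneg) (fun n => dist_le_of_DLE ?_) hz
  exact ⟨ℝ, inferInstance, inferInstance, μ01, inferInstance, X n, id, hXm n,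
    MeasurePreserving.id _, hfin n⟩


lemma BM.tensor {α : Type*} [MeasurableSpace α] {u v : α → ℝ} (hu : Measurable u)
    (hv : Measurable v) (hu1 : ∀ x, |u x| ≤ 1) (hv1 : ∀ x, |v x| ≤ 1) :
    BM (fun x y => u x * v y) :=
  ⟨(hu.comp measurable_fst).mul (hv.comp measurable_snd), 1, fun x y => by
    rw [abs_mul]; exact mul_le_one₀ (hu1 x) (abs_nonneg _) (hv1 y)⟩

lemma BM.sum {α : Type*} [MeasurableSpace α] {n : ℕ} {h : Fin n → α → α → ℝ}
    (hh : ∀ i, BM (h i)) : BM (fun x y => ∑ i, h i x y) := by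
  choose hm C hC using hh
  have hm' : ∀ i, Measurable (fun p : α × α => h i p.1 p.2) := hm
  refine ⟨?_, ∑ i, C i, fun x y => (Finset.abs_sum_le_sum_abs _ _).trans
    (Finset.sum_le_sum fun i _ => hC i x y)⟩
  have : Measurable (fun p : α × α => ∑ i, h i p.1 p.2) :=
    Finset.measurable_sum _ fun i _ => hm' i
  exact this

lemma greedy (ε : ℝ) (hε : 0 < ε) (n : ℕ) : ∀ h : Kern, BM h →
    ∫ p, h p.1 p.2 ^ 2 ∂(μ01.prod μ01) ≤ 1 →
    ∫ p, h p.1 p.2 ^ 2 ∂(μ01.prod μ01) < n * ε ^ 2 →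
    ∃ u v : Fin n → ℝ → ℝ, (∀ i, Measurable (u i)) ∧ (∀ i, Measurable (v i)) ∧
      (∀ i x, |u i x| ≤ 1) ∧ (∀ i x, |v i x| ≤ 1) ∧
      CutLE μ01 (fun x y => h x y - ∑ i, u i x * v i y) ε := by
  induction n with
  | zero =>
    intro h _ _ h2
    exfalso
    have : 0 ≤ ∫ p, h p.1 p.2 ^ 2 ∂(μ01.prod μ01) := integral_nonneg fun p => sq_nonneg _
    simp at h2
    linarith
  | succ n ih =>
    intro h hb h1 h2
    by_cases hc : CutLE μ01 h ε
    · refine ⟨fun _ _ => 0, fun _ _ => 0, fun _ => measurable_const, fun _ => measurable_const,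
        by simp, by simp, ?_⟩
      simpa using hc
    · unfold CutLE at hc
      push Not at hc
      obtain ⟨u, v, hu, hv, hu1, hv1, hgt⟩ := hc
      set c := ∫ p, h p.1 p.2 * u p.1 * v p.2 ∂(μ01.prod μ01) with hcdef
      have hhm : Measurable (fun p : ℝ × ℝ => h p.1 p.2) := hb.1
      obtain ⟨C, hC⟩ := hb.2
      have hsq : Integrable (fun p : ℝ × ℝ => h p.1 p.2 ^ 2) (μ01.prod μ01) :=
        integrable_of_bdd (by fun_prop) (C := C ^ 2) fun p => by
          rw [abs_pow]; exact pow_le_pow_left₀ (abs_nonneg _) (hC _ _) 2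
      have hlin : Integrable (fun p : ℝ × ℝ => h p.1 p.2 * u p.1 * v p.2) (μ01.prod μ01) :=
        integrable_test hb hu hv (fun x => abs_le_one_of_mem (hu1 x))
          (fun x => abs_le_one_of_mem (hv1 x))
      have hle : ∫ p, (h p.1 p.2 - c * u p.1 * v p.2) ^ 2 ∂(μ01.prod μ01) ≤
          (∫ p, h p.1 p.2 ^ 2 ∂(μ01.prod μ01)) - c ^ 2 := by
        have e : (∫ p, h p.1 p.2 ^ 2 ∂(μ01.prod μ01)) - c ^ 2 =
            ∫ p, (h p.1 p.2 ^ 2 - 2 * c * (h p.1 p.2 * u p.1 * v p.2) + c ^ 2)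
              ∂(μ01.prod μ01) := by
          have hd : Integrable (fun p : ℝ × ℝ => h p.1 p.2 ^ 2 -
              2 * c * (h p.1 p.2 * u p.1 * v p.2)) (μ01.prod μ01) :=
            hsq.sub (hlin.const_mul _)
          rw [integral_add hd (integrable_const _), integral_sub hsq (hlin.const_mul _), integral_const_mul, ← hcdef]
          simp
          ring
        rw [e]
        refine integral_mono_of_nonneg (by filter_upwards with p; positivity)
          ((hsq.sub (hlin.const_mul _)).add (integrable_const _)) ?_
        filter_upwards with p
        have a1 : (u p.1 * v p.2) ^ 2 ≤ 1 := by
          apply pow_le_one₀ (mul_nonneg (hu1 _).1 (hv1 _).1)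
          exact mul_le_one₀ (hu1 _).2 (hv1 _).1 (hv1 _).2
        have a2 : c ^ 2 * (u p.1 * v p.2) ^ 2 ≤ c ^ 2 * 1 :=
          mul_le_mul_of_nonneg_left a1 (sq_nonneg c)
        change (h p.1 p.2 - c * u p.1 * v p.2) ^ 2 ≤
          h p.1 p.2 ^ 2 - 2 * c * (h p.1 p.2 * u p.1 * v p.2) + c ^ 2
        nlinarith [a2]
      have hnn : 0 ≤ ∫ p, (h p.1 p.2 - c * u p.1 * v p.2) ^ 2 ∂(μ01.prod μ01) :=
        integral_nonneg fun p => sq_nonneg _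
      have hc1 : |c| ≤ 1 := by
        rw [← sq_le_one_iff_abs_le_one]; linarith
      have hcε : ε ^ 2 < c ^ 2 := by
        rw [← sq_abs c]; exact pow_lt_pow_left₀ hgt hε.le (by norm_num)
      have hcu : ∀ x, |c * u x| ≤ 1 := fun x => by
        rw [abs_mul]; exact mul_le_one₀ hc1 (abs_nonneg _) (abs_le_one_of_mem (hu1 x))
      obtain ⟨u', v', hu', hv', hu1', hv1', hcut⟩ := ih (fun x y => h x y - c * u x * v y)
        (hb.sub (BM.tensor (hu.const_mul c) hv hcu (fun x => abs_le_one_of_mem (hv1 x))))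
        (by have := sq_nonneg c; linarith) (by push_cast at h2; linarith)
      refine ⟨Fin.cons (fun x => c * u x) u', Fin.cons v v', ?_, ?_, ?_, ?_, ?_⟩
      · intro i; refine Fin.cases ?_ ?_ i
        · exact hu.const_mul c
        · exact hu'
      · intro i; refine Fin.cases ?_ ?_ i
        · exact hv
        · exact hv'
      · intro i; refine Fin.cases ?_ ?_ i
        · exact hcu
        · exact hu1'
      · intro i; refine Fin.cases ?_ ?_ i
        · exact fun x => abs_le_one_of_mem (hv1 x)
        · exact hv1'
      · simpa [Fin.sum_univ_succ, sub_sub] using hcut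

lemma weak_reg (ε : ℝ) (hε : 0 < ε) : ∃ n : ℕ, ∀ f : Kern, IsGraphon f →
    ∃ u v : Fin n → ℝ → ℝ, (∀ i, Measurable (u i)) ∧ (∀ i, Measurable (v i)) ∧
      (∀ i x, |u i x| ≤ 1) ∧ (∀ i x, |v i x| ≤ 1) ∧
      CutLE μ01 (fun x y => f x y - ∑ i, u i x * v i y) ε := by
  obtain ⟨n, hn⟩ := exists_nat_gt (1 / ε ^ 2)
  rw [div_lt_iff₀ (by positivity)] at hn
  refine ⟨n, fun f hf => ?_⟩
  have h1 : ∫ p, f p.1 p.2 ^ 2 ∂(μ01.prod μ01) ≤ 1 := by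
    have := integral_mono_of_nonneg (μ := μ01.prod μ01) (f := fun p => f p.1 p.2 ^ 2)
      (g := fun _ => (1:ℝ)) (by filter_upwards with p; positivity) (integrable_const _)
      (by filter_upwards with p; exact pow_le_one₀ (hf.2 _ _).1 (hf.2 _ _).2)
    simpa using this
  exact greedy ε hε n f hf.bm h1 (by linarith)

/-- Quantizer. -/
noncomputable def qz (M : ℕ) (s : ℝ) : Fin (2 * M + 1) :=
  ⟨min ⌊(s + 1) * M⌋₊ (2 * M), by omega⟩

lemma qz_meas (M : ℕ) : Measurable (qz M) := by
  have h1 : Measurable (fun s : ℝ => ⌊(s + 1) * M⌋₊) := by fun_prop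
  have h2 : Measurable (fun j : ℕ => (⟨min j (2 * M), by omega⟩ : Fin (2 * M + 1))) :=
    measurable_from_top
  exact h2.comp h1

lemma qz_eq (M : ℕ) (hM : 0 < M) {s t : ℝ} (hs : |s| ≤ 1) (ht : |t| ≤ 1)
    (h : qz M s = qz M t) : |s - t| ≤ 1 / M := by
  have hM' : (0:ℝ) < M := by exact_mod_cast hM
  have key : ∀ s : ℝ, |s| ≤ 1 → ⌊(s + 1) * M⌋₊ ≤ 2 * M := by
    intro s hs
    have := (abs_le.1 hs).2
    apply Nat.floor_le_of_le
    push_cast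
    nlinarith
  have h1 := congrArg Fin.val h
  simp only [qz, min_eq_left (key s hs), min_eq_left (key t ht)] at h1
  have p1 : 0 ≤ (s + 1) * M := mul_nonneg (by linarith [(abs_le.1 hs).1]) hM'.le
  have p2 : 0 ≤ (t + 1) * M := mul_nonneg (by linarith [(abs_le.1 ht).1]) hM'.le
  have a1 := Nat.floor_le p1
  have a2 := Nat.lt_floor_add_one ((s + 1) * M)
  have b1 := Nat.floor_le p2
  have b2 := Nat.lt_floor_add_one ((t + 1) * M)
  rw [h1] at a1 a2
  rw [le_div_iff₀ hM', ← abs_of_pos hM', ← abs_mul, abs_le]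
  constructor <;> nlinarith

/-- Thinned label. -/
noncomputable def thin {n : ℕ} (l : ℝ → Fin n) (s : Fin n → ℝ) (p : ℝ × ℝ) : Fin (n + 1) :=
  if p.2 ≤ s (l p.1) then (l p.1).succ else 0

lemma thin_meas {n : ℕ} {l : ℝ → Fin n} (hl : Measurable l) (s : Fin n → ℝ) :
    Measurable (thin l s) := by
  have hs : Measurable s := measurable_of_finite s
  have h2 : Measurable (Fin.succ : Fin n → Fin (n+1)) := measurable_of_finite _
  refine Measurable.ite ?_ (h2.comp (hl.comp measurable_fst)) measurable_const
  exact measurableSet_le measurable_snd (hs.comp (hl.comp measurable_fst))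

lemma thin_law {n : ℕ} {l : ℝ → Fin n} (hl : Measurable l) (s : Fin n → ℝ)
    (hs : ∀ i, s i ∈ Icc (0:ℝ) 1) (i : Fin n) :
    ((μ01.prod μ01).map (thin l s)).real {i.succ} = μ01.real (l ⁻¹' {i}) * s i := by
  rw [map_measureReal_apply (thin_meas hl s) (measurableSet_singleton _)]
  have : thin l s ⁻¹' {i.succ} = (l ⁻¹' {i}) ×ˢ (Iic (s i)) := by
    ext p
    simp only [thin, mem_preimage, mem_singleton_iff, mem_prod, mem_Iic]
    split_ifs with h
    · simp only [Fin.succ_inj]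
      constructor
      · intro h'; exact ⟨h', by rwa [h'] at h⟩
      · exact fun h' => h'.1
    · constructor
      · intro h'; exact absurd h'.symm (Fin.succ_ne_zero i)
      · rintro ⟨h', h''⟩; rw [h'] at h; exact absurd h'' h
  rw [this, measureReal_prod_prod]
  congr 1
  rw [measureReal_restrict_apply measurableSet_Iic]
  have : Iic (s i) ∩ Icc 0 1 = Icc 0 (s i) := by
    ext x; simp only [mem_inter_iff, mem_Iic, mem_Icc]
    constructor
    · rintro ⟨a, b, c⟩; exact ⟨b, a⟩
    · rintro ⟨a, b⟩; exact ⟨b, a, b.trans (hs i).2⟩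
  rw [this]
  simp [measureReal_def, (hs i).1]

lemma sum_real_one {n : ℕ} (ν : Measure (Fin n)) [IsProbabilityMeasure ν] :
    ∑ i, ν.real {i} = 1 := by
  have := sum_measureReal_singleton (μ := ν) (Finset.univ : Finset (Fin n))
  rw [this]; simp

lemma law_ext {n : ℕ} (ν ν' : Measure (Fin (n+1))) [IsProbabilityMeasure ν]
    [IsProbabilityMeasure ν'] (h : ∀ i : Fin n, ν.real {i.succ} = ν'.real {i.succ}) : ν = ν' := by
  have h1 := sum_real_one ν
  have h2 := sum_real_one ν'
  rw [Fin.sum_univ_succ] at h1 h2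
  rw [Finset.sum_congr rfl fun i _ => h i] at h1
  have h0 : ν.real {0} = ν'.real {0} := by linarith
  apply Measure.ext_of_singleton
  intro i
  rw [← measureReal_eq_measureReal_iff]
  refine Fin.cases h0 h i

lemma label_couple {n : ℕ} (N : ℕ) (hN : 0 < N) (l l' : ℝ → Fin n) (hl : Measurable l)
    (hl' : Measurable l')
    (h : ∀ i, ⌊N * μ01.real (l ⁻¹' {i})⌋₊ = ⌊N * μ01.real (l' ⁻¹' {i})⌋₊) :
    ∃ X Y : (ℝ × ℝ) × ℝ → ℝ, ∃ B : Set ((ℝ × ℝ) × ℝ),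
      MeasurePreserving X ((μ01.prod μ01).prod μ01) μ01 ∧
      MeasurePreserving Y ((μ01.prod μ01).prod μ01) μ01 ∧ MeasurableSet B ∧
      ((μ01.prod μ01).prod μ01).real B ≤ n / N ∧
      ∀ᵐ w ∂((μ01.prod μ01).prod μ01), w ∉ B → l (X w) = l' (Y w) := by
  have hN' : (0:ℝ) < N := by exact_mod_cast hN
  set s : (ℝ → Fin n) → Fin n → ℝ := fun l i =>
    ⌊N * μ01.real (l ⁻¹' {i})⌋₊ / (N * μ01.real (l ⁻¹' {i})) with hs
  have hs1 : ∀ l i, s l i ∈ Icc (0:ℝ) 1 := fun l i => by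
    refine ⟨by simp only [hs]; positivity, ?_⟩
    simp only [hs]
    exact div_le_one_of_le₀ (Nat.floor_le (by positivity)) (by positivity)
  have hlaw : ∀ l : ℝ → Fin n, Measurable l → ∀ i,
      ((μ01.prod μ01).map (thin l (s l))).real {i.succ} =
        ⌊N * μ01.real (l ⁻¹' {i})⌋₊ / N := by
    intro l hl i
    rw [thin_law hl _ (hs1 l)]
    simp only [hs]
    by_cases h0 : μ01.real (l ⁻¹' {i}) = 0
    · simp [h0]
    · field_simp
  have iP : ∀ l : ℝ → Fin n, Measurable l →
      IsProbabilityMeasure ((μ01.prod μ01).map (thin l (s l))) := fun l hl =>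
    Measure.isProbabilityMeasure_map (thin_meas hl _).aemeasurable
  have := iP l hl
  have := iP l' hl'
  have hmap : (μ01.prod μ01).map (thin l (s l)) = (μ01.prod μ01).map (thin l' (s l')) := by
    apply law_ext
    intro i
    rw [hlaw l hl, hlaw l' hl', h i]
  obtain ⟨b, hb, hbe⟩ := glue (μ01.prod μ01) (μ01.prod μ01) _ _ (thin_meas hl (s l))
    (thin_meas hl' (s l')) hmap
  refine ⟨Prod.fst ∘ Prod.fst, Prod.fst ∘ b, {w | thin l (s l) w.1 = 0},
    measurePreserving_fst.comp measurePreserving_fst, measurePreserving_fst.comp hb,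
    ((thin_meas hl _).comp measurable_fst) (measurableSet_singleton _), ?_, ?_⟩
  · have e1 : ((μ01.prod μ01).prod μ01).real {w | thin l (s l) w.1 = 0} =
        ((μ01.prod μ01).map (thin l (s l))).real {0} := by
      have hf : MeasurePreserving (Prod.fst : (ℝ × ℝ) × ℝ → ℝ × ℝ)
        ((μ01.prod μ01).prod μ01) (μ01.prod μ01) := measurePreserving_fst
      rw [map_measureReal_apply (thin_meas hl _) (measurableSet_singleton _)]
      simp only [measureReal_def]
      rw [← hf.measure_preimage ((thin_meas hl _) (measurableSet_singleton _)).nullMeasurableSet]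
      rfl
    rw [e1]
    have h1 := sum_real_one ((μ01.prod μ01).map (thin l (s l)))
    rw [Fin.sum_univ_succ, Finset.sum_congr rfl fun i _ => hlaw l hl i] at h1
    have iQ : IsProbabilityMeasure (μ01.map l) :=
      Measure.isProbabilityMeasure_map hl.aemeasurable
    have h2 := sum_real_one (μ01.map l)
    have h3 : ∑ i, (((μ01.map l).real {i} : ℝ) - 1 / N) ≤
        ∑ i, (⌊N * μ01.real (l ⁻¹' {i})⌋₊ / N : ℝ) := by
      refine Finset.sum_le_sum fun i _ => ?_
      rw [map_measureReal_apply hl (measurableSet_singleton _), le_div_iff₀ hN', sub_mul,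
        one_div, inv_mul_cancel₀ hN'.ne']
      have := Nat.lt_floor_add_one (N * μ01.real (l ⁻¹' {i}))
      nlinarith
    rw [Finset.sum_sub_distrib, h2] at h3
    simp only [Finset.sum_const, Finset.card_univ, Fintype.card_fin, nsmul_eq_mul] at h3
    have : (n:ℝ) * (1 / N) = n / N := by ring
    linarith
  · filter_upwards [hbe] with w hw hwB
    change ¬ (thin l (s l) w.1 = 0) at hwB
    simp only [Function.comp]
    have hne : thin l' (s l') (b w) ≠ 0 := by rw [hw]; exact hwB
    have t1 : thin l (s l) w.1 = (l w.1.1).succ := by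
      unfold thin at hwB ⊢
      split_ifs at hwB ⊢ with hh
      · rfl
      · exact absurd rfl hwB
    have t2 : thin l' (s l') (b w) = (l' (b w).1).succ := by
      unfold thin at hne ⊢
      split_ifs at hne ⊢ with hh
      · rfl
      · exact absurd rfl hne
    rw [t1, t2] at hw
    exact (Fin.succ_inj.1 hw).symm


lemma mid_bound {k : ℕ} (M : ℕ) (hM : 0 < M) {Ω : Type*} [MeasurableSpace Ω] (P : Measure Ω)
    [IsProbabilityMeasure P] (u v u' v' : Fin k → Ω → ℝ)
    (hu : ∀ i, Measurable (u i)) (hv : ∀ i, Measurable (v i))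
    (hu' : ∀ i, Measurable (u' i)) (hv' : ∀ i, Measurable (v' i))
    (hu1 : ∀ i x, |u i x| ≤ 1) (hv1 : ∀ i x, |v i x| ≤ 1)
    (hu1' : ∀ i x, |u' i x| ≤ 1) (hv1' : ∀ i x, |v' i x| ≤ 1)
    (B : Set Ω) (hB : MeasurableSet B) (r : ℝ) (hr : P.real B ≤ r)
    (hq : ∀ᵐ w ∂P, w ∉ B → ∀ i, |u i w - u' i w| ≤ 1 / M ∧ |v i w - v' i w| ≤ 1 / M) :
    CutLE P (fun x y => (∑ i, u i x * v i y) - ∑ i, u' i x * v' i y)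
      (k * (2 / M) + 2 * k * (r + r)) := by
  have hM' : (0:ℝ) < M := by exact_mod_cast hM
  have hb : BM (fun x y => (∑ i, u i x * v i y) - ∑ i, u' i x * v' i y) :=
    (BM.sum fun i => BM.tensor (hu i) (hv i) (hu1 i) (hv1 i)).sub
      (BM.sum fun i => BM.tensor (hu' i) (hv' i) (hu1' i) (hv1' i))
  apply CutLE.of_l1 hb
  set ib : Ω → ℝ := B.indicator fun _ => (1:ℝ) with hib
  have hibm : Measurable ib := measurable_const.indicator hB
  have hib0 : ∀ w, 0 ≤ ib w := fun w => indicator_nonneg (fun _ _ => zero_le_one) w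
  have hib1 : ∀ w, |ib w| ≤ 1 := fun w => by
    by_cases h : w ∈ B <;> simp [hib, h]
  have hibint : ∫ w, ib w ∂P = P.real B := by
    rw [hib, integral_indicator hB]; simp
  have i1 : Integrable (fun p : Ω × Ω => ib p.1) (P.prod P) :=
    integrable_of_bdd (hibm.comp measurable_fst) fun p => hib1 _
  have i2 : Integrable (fun p : Ω × Ω => ib p.2) (P.prod P) :=
    integrable_of_bdd (hibm.comp measurable_snd) fun p => hib1 _
  have e1 : ∫ p : Ω × Ω, ib p.1 ∂(P.prod P) = P.real B := by
    have := integral_fun_fst (μ := P) (ν := P) ib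
    rw [this, hibint]; simp
  have e2 : ∫ p : Ω × Ω, ib p.2 ∂(P.prod P) = P.real B := by
    have := integral_fun_snd (μ := P) (ν := P) ib
    rw [this, hibint]; simp
  have i12 : Integrable (fun p : Ω × Ω => ib p.1 + ib p.2) (P.prod P) := i1.add i2
  have hle : ∫ p : Ω × Ω, |(∑ i, u i p.1 * v i p.2) - ∑ i, u' i p.1 * v' i p.2| ∂(P.prod P) ≤
      ∫ p : Ω × Ω, (k * (2 / M) + 2 * k * (ib p.1 + ib p.2)) ∂(P.prod P) := by
    refine integral_mono_of_nonneg (by filter_upwards with p; positivity)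
      ((integrable_const _).add (i12.const_mul _)) ?_
    have q1 := (measurePreserving_fst (μ := P) (ν := P)).quasiMeasurePreserving.ae hq
    have q2 := (measurePreserving_snd (μ := P) (ν := P)).quasiMeasurePreserving.ae hq
    filter_upwards [q1, q2] with p h1 h2
    rw [← Finset.sum_sub_distrib]
    have hterm : ∀ i, |u i p.1 * v i p.2 - u' i p.1 * v' i p.2| ≤
        2 / M + 2 * (ib p.1 + ib p.2) := by
      intro i
      have g1 := hib0 p.1
      have g2 := hib0 p.2
      by_cases hB' : p.1 ∈ B ∨ p.2 ∈ B
      · have : 1 ≤ ib p.1 + ib p.2 := by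
          rcases hB' with h | h
          · have : ib p.1 = 1 := by simp [hib, h]
            linarith
          · have : ib p.2 = 1 := by simp [hib, h]
            linarith
        have a1 : |u i p.1 * v i p.2| ≤ 1 := by
          rw [abs_mul]; exact mul_le_one₀ (hu1 i _) (abs_nonneg _) (hv1 i _)
        have a2 : |u' i p.1 * v' i p.2| ≤ 1 := by
          rw [abs_mul]; exact mul_le_one₀ (hu1' i _) (abs_nonneg _) (hv1' i _)
        have a3 := abs_sub (u i p.1 * v i p.2) (u' i p.1 * v' i p.2)
        have : 0 < 2 / (M:ℝ) := by positivity
        linarith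
      · push Not at hB'
        have d1 := (h1 hB'.1 i).1
        have d2 := (h2 hB'.2 i).2
        have e : u i p.1 * v i p.2 - u' i p.1 * v' i p.2 =
            (u i p.1 - u' i p.1) * v i p.2 + u' i p.1 * (v i p.2 - v' i p.2) := by ring
        rw [e]
        refine (abs_add_le _ _).trans ?_
        rw [abs_mul, abs_mul]
        have f1 : |u i p.1 - u' i p.1| * |v i p.2| ≤ 1 / M * 1 := by
          gcongr; exact hv1 i _
        have f2 : |u' i p.1| * |v i p.2 - v' i p.2| ≤ 1 * (1 / M) := by
          gcongr; exact hu1' i _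
        have : 2 / (M:ℝ) = 1 / M + 1 / M := by ring
        linarith
    refine (Finset.abs_sum_le_sum_abs _ _).trans ((Finset.sum_le_sum fun i _ => hterm i).trans ?_)
    simp only [Finset.sum_const, Finset.card_univ, Fintype.card_fin, nsmul_eq_mul]
    apply le_of_eq
    ring
  refine hle.trans ?_
  rw [integral_add (integrable_const _) (i12.const_mul _),
    integral_const_mul (2 * (k:ℝ)),
    integral_add i1 i2, e1, e2]
  simp only [integral_const, probReal_univ, one_smul]
  gcongr

lemma tot_bdd : TotallyBounded (univ : Set GraphonT) := by
  apply Metric.totallyBounded_of_finite_discretization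
  intro ε hε
  obtain ⟨k, hk⟩ := weak_reg (ε / 8) (by positivity)
  choose! u v hu hv hu1 hv1 hcut using hk
  obtain ⟨M, hM⟩ := exists_nat_gt (max 1 (16 * k / ε))
  have hM1 : (1:ℝ) < M := (le_max_left _ _).trans_lt hM
  have hM2 : 16 * k / ε < M := (le_max_right _ _).trans_lt hM
  have hM0 : 0 < M := by
    have : (0:ℝ) < M := by linarith
    exact_mod_cast this
  let L := Fin k → Fin (2 * M + 1) × Fin (2 * M + 1)
  let n := Fintype.card L
  let eL : L ≃ Fin n := Fintype.equivFin L
  let lab : Kern → ℝ → Fin n := fun f x => eL fun i => (qz M (u f i x), qz M (v f i x))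
  have hlab : ∀ f, IsGraphon f → Measurable (lab f) := by
    intro f hf
    have h1 : Measurable (fun x => (fun i => (qz M (u f i x), qz M (v f i x)) : L)) :=
      measurable_pi_lambda _ fun i =>
        ((qz_meas M).comp (hu f hf i)).prodMk ((qz_meas M).comp (hv f hf i))
    have h2 : Measurable (eL : L → Fin n) := measurable_of_finite _
    exact h2.comp h1
  obtain ⟨N, hN⟩ := exists_nat_gt (max 1 (32 * k * n / ε))
  have hN1 : (1:ℝ) < N := (le_max_left _ _).trans_lt hN
  have hN2 : 32 * k * n / ε < N := (le_max_right _ _).trans_lt hN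
  have hN0 : 0 < N := by
    have : (0:ℝ) < N := by linarith
    exact_mod_cast this
  have hfl : ∀ (f : Kern) (i : Fin n), ⌊N * μ01.real (lab f ⁻¹' {i})⌋₊ < N + 1 := by
    intro f i
    have : μ01.real (lab f ⁻¹' {i}) ≤ 1 := measureReal_le_one
    refine Nat.lt_succ_of_le (Nat.floor_le_of_le ?_)
    nlinarith
  refine ⟨Fin n → Fin (N + 1), inferInstance, fun f i => ⟨_, hfl f.1.1 i⟩, ?_⟩
  rintro ⟨⟨f, hf⟩, _⟩ ⟨⟨g, hg⟩, _⟩ hfg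
  have hfg' : ∀ i, ⌊N * μ01.real (lab f ⁻¹' {i})⌋₊ = ⌊N * μ01.real (lab g ⁻¹' {i})⌋₊ := by
    intro i
    exact congrArg Fin.val (congrFun hfg i)
  obtain ⟨X, Y, B, hX, hY, hB, hBr, hae⟩ := label_couple N hN0 (lab f) (lab g) (hlab f hf)
    (hlab g hg) hfg'
  have c1 := (hcut f hf).pull (hf.bm.sub (BM.sum fun i => BM.tensor (hu f hf i) (hv f hf i)
    (hu1 f hf i) (hv1 f hf i))) hX
  have c3 := ((hcut g hg).pull (hg.bm.sub (BM.sum fun i => BM.tensor (hu g hg i) (hv g hg i)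
    (hu1 g hg i) (hv1 g hg i))) hY).neg
  have c2 := mid_bound M hM0 ((μ01.prod μ01).prod μ01)
    (fun i w => u f i (X w)) (fun i w => v f i (X w))
    (fun i w => u g i (Y w)) (fun i w => v g i (Y w))
    (fun i => (hu f hf i).comp hX.measurable) (fun i => (hv f hf i).comp hX.measurable)
    (fun i => (hu g hg i).comp hY.measurable) (fun i => (hv g hg i).comp hY.measurable)
    (fun i w => hu1 f hf i _) (fun i w => hv1 f hf i _)
    (fun i w => hu1 g hg i _) (fun i w => hv1 g hg i _) B hB (n / N) hBr (by
      filter_upwards [hae] with w hw hwB i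
      have h1 := congrFun (eL.injective (hw hwB)) i
      simp only [Prod.mk.injEq] at h1
      exact ⟨qz_eq M hM0 (hu1 f hf i _) (hu1 g hg i _) h1.1,
        qz_eq M hM0 (hv1 f hf i _) (hv1 g hg i _) h1.2⟩)
  have bF := (BM.sum fun i => BM.tensor (hu f hf i) (hv f hf i)
    (hu1 f hf i) (hv1 f hf i)).comp hX.measurable
  have bG := (BM.sum fun i => BM.tensor (hu g hg i) (hv g hg i)
    (hu1 g hg i) (hv1 g hg i)).comp hY.measurable
  have bf := hf.bm.comp hX.measurable
  have bg := hg.bm.comp hY.measurable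
  have c12 := c1.add (bf.sub bF) (bF.sub bG) c2
  have c123 := c12.add ((bf.sub bF).add (bF.sub bG)) (bg.sub bG).neg c3
  have hD : DLE f g (ε / 8 + (k * (2 / M) + 2 * k * (n / N + n / N)) + ε / 8) := by
    refine ⟨(ℝ × ℝ) × ℝ, inferInstance, inferInstance, (μ01.prod μ01).prod μ01, inferInstance,
      X, Y, hX, hY, c123.congr_ae ?_⟩
    filter_upwards with p
    ring
  refine lt_of_le_of_lt (dist_le_of_DLE (f := (⟨f, hf⟩ : GraphonT)) (g := (⟨g, hg⟩ : GraphonT)) hD) ?_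
  have b1 : (k:ℝ) * (2 / M) ≤ ε / 8 := by
    rw [div_lt_iff₀ hε] at hM2
    rw [mul_div_assoc', div_le_iff₀ (by linarith)]
    nlinarith
  have b2 : 2 * (k:ℝ) * (n / N + n / N) ≤ ε / 8 := by
    rw [div_lt_iff₀ hε] at hN2
    rw [← add_div, mul_div_assoc', div_le_iff₀ (by linarith)]
    nlinarith
  linarith

instance : CompactSpace GraphonT :=
  ⟨isCompact_iff_totallyBounded_isComplete.2 ⟨tot_bdd, isClosed_univ.isComplete⟩⟩


/-- Disjoint union of multigraphs. -/
def MG.dunion (G H : MG) : MG where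
  nv := G.nv + H.nv
  ne := G.ne + H.ne
  s := Fin.addCases (fun e => Fin.castAdd H.nv (G.s e)) (fun e => Fin.natAdd G.nv (H.s e))
  t := Fin.addCases (fun e => Fin.castAdd H.nv (G.t e)) (fun e => Fin.natAdd G.nv (H.t e))
  noLoop := by
    intro e
    refine Fin.addCases (fun e => ?_) (fun e => ?_) e
    · simpa using fun h => G.noLoop e h
    · simpa using fun h => H.noLoop e h

/-- The empty graph. -/
def MG.emp : MG := ⟨0, 0, Fin.elim0, Fin.elim0, fun e => Fin.elim0 e⟩

lemma simple_iff (G : MG) : IsSimpleMG G ↔ ∀ e e', (∀ x, (x = G.s e ∨ x = G.t e) ↔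
    (x = G.s e' ∨ x = G.t e')) → e = e' := by
  have : ∀ e e', (({G.s e, G.t e} : Finset (Fin G.nv)) = ({G.s e', G.t e'} : Finset (Fin G.nv))) ↔
      (∀ x, (x = G.s e ∨ x = G.t e) ↔ (x = G.s e' ∨ x = G.t e')) := by
    intro e e'
    rw [Finset.ext_iff]
    simp only [Finset.mem_insert, Finset.mem_singleton]
  unfold IsSimpleMG
  simp only [this]

lemma dunion_simple {G H : MG} (hG : IsSimpleMG G) (hH : IsSimpleMG H) :
    IsSimpleMG (G.dunion H) := by
  have cn : ∀ (a : Fin G.nv) (b : Fin H.nv), Fin.castAdd H.nv a ≠ Fin.natAdd G.nv b := by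
    intro a b h
    have := congrArg Fin.val h
    simp at this
    omega
  rw [simple_iff] at hG hH ⊢
  change ∀ e e' : Fin (G.ne + H.ne), _
  intro e e'
  refine Fin.addCases (fun e => ?_) (fun e => ?_) e <;>
    refine Fin.addCases (fun e' => ?_) (fun e' => ?_) e' <;>
    simp only [MG.dunion, Fin.addCases_left, Fin.addCases_right] <;> intro h
  · congr 1
    apply hG
    intro a
    simpa [Fin.castAdd_inj] using h (Fin.castAdd H.nv a)
  · exfalso
    have := (h (Fin.castAdd H.nv (G.s e))).1 (Or.inl rfl)
    simp [cn] at this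
  · exfalso
    have := (h (Fin.castAdd H.nv (G.s e'))).2 (Or.inl rfl)
    simp [cn] at this
  · congr 1
    apply hH
    intro a
    simpa using h (Fin.natAdd G.nv a)

lemma emp_simple : IsSimpleMG MG.emp := fun e => Fin.elim0 e

lemma homDensity_emp (f : Kern) : homDensity MG.emp f = 1 := by
  have h : ∀ x : Fin MG.emp.nv → ℝ,
      ∏ e : Fin MG.emp.ne, f (x (MG.emp.s e)) (x (MG.emp.t e)) = 1 := by
    intro x
    apply Finset.prod_eq_one
    intro e
    exact Fin.elim0 e
  unfold homDensity
  simp only [h]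
  simp

lemma mp_split (m n : ℕ) : MeasurePreserving
    (fun x : Fin (m + n) → ℝ => ((fun i => x (Fin.castAdd n i)), (fun i => x (Fin.natAdd m i))))
    (Measure.pi fun _ => μ01) ((Measure.pi fun _ => μ01).prod (Measure.pi fun _ => μ01)) := by
  have h1 := (measurePreserving_piCongrLeft (α := fun _ : Fin (m + n) => ℝ)
    (fun _ => μ01) (finSumFinEquiv (m := m) (n := n))).symm
  have h2 := measurePreserving_sumPiEquivProdPi (X := fun _ : Fin m ⊕ Fin n => ℝ) (fun _ => μ01)
  exact h2.comp h1

lemma homDensity_dunion (G H : MG) {f : Kern} (hf : IsGraphon f) :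
    homDensity (G.dunion H) f = homDensity G f * homDensity H f := by
  have hfm : Measurable (fun p : ℝ × ℝ => f p.1 p.2) := hf.1.1
  have hm : ∀ G : MG, Measurable (fun x : Fin G.nv → ℝ => ∏ e : Fin G.ne, f (x (G.s e)) (x (G.t e))) :=
    fun G => Finset.measurable_prod _ fun e _ => by
      change Measurable ((fun p : ℝ × ℝ => f p.1 p.2) ∘ fun x : Fin G.nv → ℝ => (x (G.s e), x (G.t e)))
      exact
      hfm.comp ((measurable_pi_apply (G.s e)).prodMk (measurable_pi_apply (G.t e)))
  have hmp := mp_split G.nv H.nv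
  unfold homDensity
  rw [← integral_prod_mul, ← hmp.map_eq, integral_map hmp.measurable.aemeasurable]
  · apply integral_congr_ae
    filter_upwards with x
    change ∏ e : Fin (G.ne + H.ne), _ = _
    rw [Fin.prod_univ_add]
    simp [MG.dunion]
  · exact (((hm G).comp measurable_fst).mul ((hm H).comp measurable_snd)).aestronglyMeasurable

/-- Simple multigraphs. -/
abbrev SMG : Type := {G : MG // IsSimpleMG G}

/-- All simple densities at once. -/
noncomputable def TT (f : GraphonT) : SMG → ℝ := fun G => homDensity G.1 f.1

lemma TT_cont : Continuous TT := continuous_pi fun G => homDensity_cont G.1 G.2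

/-- Coordinate functions on the image. -/
def coordF (G : SMG) : C(range TT, ℝ) :=
  ⟨fun y => y.1 G, (continuous_apply G).comp continuous_subtype_val⟩

/-- The submonoid of coordinate functions. -/
noncomputable def coordM : Submonoid C(range TT, ℝ) where
  carrier := range coordF
  one_mem' := by
    refine ⟨⟨MG.emp, emp_simple⟩, ?_⟩
    ext ⟨y, f, rfl⟩
    exact homDensity_emp f.1
  mul_mem' := by
    rintro _ _ ⟨G, rfl⟩ ⟨H, rfl⟩
    refine ⟨⟨G.1.dunion H.1, dunion_simple G.2 H.2⟩, ?_⟩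
    ext ⟨y, f, rfl⟩
    exact homDensity_dunion G.1 H.1 f.2

/-- Density theorem. The linear span of simple-graph homomorphism
densities is uniformly dense in the space of cut-norm continuous class functions. -/
theorem stmt1 (F : Kern → ℝ) (hclass : IsClassFun F) (hcont : CutContOn F)
    (ε : ℝ) (hε : 0 < ε) :
    ∃ (m : ℕ) (H : Fin m → MG) (c : Fin m → ℝ),
      (∀ i, IsSimpleMG (H i)) ∧
      ∀ f ∈ Graphons, |F f - ∑ i, c i * homDensity (H i) f| < ε := by
  have : CompactSpace (range TT) := isCompact_iff_compactSpace.1 (isCompact_range TT_cont)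
  let T' : GraphonT → range TT := rangeFactorization TT
  have hT'c : Continuous T' := TT_cont.subtype_mk _
  have hT's : Function.Surjective T' := rangeFactorization_surjective
  have hq : IsQuotientMap T' := hT'c.isClosedMap.isQuotientMap hT'c hT's
  let F' : range TT → ℝ := fun y => F (Function.surjInv hT's y).1
  have hF' : ∀ f : GraphonT, F' (T' f) = F f.1 := by
    intro f
    have h1 : T' (Function.surjInv hT's (T' f)) = T' f := Function.surjInv_eq hT's _
    refine hclass _ _ (Function.surjInv hT's (T' f)).2 f.2 fun G hG => ?_
    exact congrFun (congrArg Subtype.val h1) ⟨G, hG⟩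
  have hF'c : Continuous F' := by
    rw [hq.continuous_iff]
    have : F' ∘ T' = fun f : GraphonT => F f.1 := funext hF'
    rw [this]
    exact F_cont F hclass hcont
  let A : Subalgebra ℝ C(range TT, ℝ) := Algebra.adjoin ℝ (range coordF)
  have hsep : A.SeparatesPoints := by
    intro x y hxy
    have : ∃ G, x.1 G ≠ y.1 G := by
      by_contra hcon
      push Not at hcon
      exact hxy (Subtype.ext (funext hcon))
    obtain ⟨G, hG⟩ := this
    exact ⟨coordF G, ⟨coordF G, Algebra.subset_adjoin ⟨G, rfl⟩, rfl⟩, hG⟩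
  obtain ⟨⟨g, hgA⟩, hg⟩ := ContinuousMap.exists_mem_subalgebra_near_continuous_of_separatesPoints
    A hsep F' hF'c ε hε
  have hspan : g ∈ Submodule.span ℝ (range coordF) := by
    have h1 : g ∈ Subalgebra.toSubmodule A := hgA
    rw [Algebra.adjoin_eq_span] at h1
    have h2 : Submonoid.closure (range coordF) = coordM := Submonoid.closure_eq coordM
    rw [h2] at h1
    exact h1
  rw [Finsupp.mem_span_range_iff_exists_finsupp] at hspan
  obtain ⟨c, hc⟩ := hspan
  let e := c.support.equivFin
  refine ⟨c.support.card, fun i => (e.symm i).1.1, fun i => c (e.symm i).1,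
    fun i => (e.symm i).1.2, fun f hf => ?_⟩
  have h1 := hg (T' ⟨f, hf⟩)
  have h2 : g (T' ⟨f, hf⟩) = ∑ i, c (e.symm i).1 * homDensity (e.symm i).1.1 f := by
    rw [e.symm.sum_comp (fun G => c G.1 * homDensity G.1.1 f),
      Finset.sum_coe_sort c.support (fun G => c G * homDensity G.1 f), ← hc, Finsupp.sum]
    simp only [ContinuousMap.coe_sum, Finset.sum_apply, ContinuousMap.coe_smul, Pi.smul_apply,
      smul_eq_mul]
    rfl
  have h3 : F' (T' ⟨f, hf⟩) = F f := hF' ⟨f, hf⟩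
  rw [← h2, ← h3, abs_sub_comm]
  exact h1
end

section
/- Let f₁, …, f_k ∈ W be graphons that are pairwise non-weakly-equivalent (for each i ≠ j there exists a finite simple graph H with t(H,f_i) ≠ t(H,f_j)), and let a₁, …, a_k ∈ ℝ be arbitrary. Then there exist finitely many finite simple graphs H₁, …, H_m and scalars c₁, …, c_m such that Σ_{i=1}^m c_i·t(H_i, f_j) = a_j for all 1 ≤ j ≤ k. -/
open MeasureTheory Filter Set Topology
open scoped BigOperators Classical ENNReal

/-- Disjoint union of multigraphs. -/
def MG.disj (G H : MG) : MG where
  nv := G.nv + H.nv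
  ne := G.ne + H.ne
  s := Fin.addCases (fun e => Fin.castAdd H.nv (G.s e)) (fun e => Fin.natAdd G.nv (H.s e))
  t := Fin.addCases (fun e => Fin.castAdd H.nv (G.t e)) (fun e => Fin.natAdd G.nv (H.t e))
  noLoop := by
    intro e
    induction e using Fin.addCases with
    | left e =>
      simp only [Fin.addCases_left]
      intro h
      exact G.noLoop e (Fin.castAdd_injective _ _ h)
    | right e =>
      simp only [Fin.addCases_right]
      intro h
      exact H.noLoop e (Fin.natAdd_injective _ _ h)

theorem pairset_eq_iff {α : Type*} [DecidableEq α] (a b c d : α) :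
    ({a, b} : Finset α) = {c, d} ↔ (a = c ∧ b = d) ∨ (a = d ∧ b = c) := by
  rw [← Finset.coe_inj]
  push_cast
  exact Set.pair_eq_pair_iff

theorem disj_simple (G H : MG) (hG : IsSimpleMG G) (hH : IsSimpleMG H) :
    IsSimpleMG (G.disj H) := by
  intro e e' h
  rw [pairset_eq_iff] at h
  change Fin (G.ne + H.ne) at e e'
  induction e using Fin.addCases with
  | left e =>
    induction e' using Fin.addCases with
    | left e' =>
      simp only [MG.disj, Fin.addCases_left, Fin.castAdd_inj] at h
      rw [hG e e' ((pairset_eq_iff _ _ _ _).2 h)]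
    | right e' =>
      simp only [MG.disj, Fin.addCases_left, Fin.addCases_right, Fin.ext_iff,
        Fin.val_castAdd, Fin.val_natAdd] at h
      have := (G.s e).isLt
      omega
  | right e =>
    induction e' using Fin.addCases with
    | left e' =>
      simp only [MG.disj, Fin.addCases_left, Fin.addCases_right, Fin.ext_iff,
        Fin.val_castAdd, Fin.val_natAdd] at h
      have := (G.s e').isLt
      have := (G.t e').isLt
      omega
    | right e' =>
      simp only [MG.disj, Fin.addCases_right, Fin.natAdd_inj] at h
      rw [hH e e' ((pairset_eq_iff _ _ _ _).2 h)]

theorem homDensity_disj (G H : MG) (f : Kern) :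
    homDensity (G.disj H) f = homDensity G f * homDensity H f := by
  have h1 := measurePreserving_piCongrLeft (fun _ : Fin (G.nv + H.nv) => μ01)
    (finSumFinEquiv (m := G.nv) (n := H.nv))
  have h2 := measurePreserving_sumPiEquivProdPi_symm (fun _ : Fin G.nv ⊕ Fin H.nv => μ01)
  unfold homDensity
  rw [← integral_prod_mul]
  refine ((h1.integral_comp' _).symm.trans (h2.integral_comp' _).symm).trans ?_
  refine integral_congr_ae (Filter.Eventually.of_forall fun z => ?_)
  have hl : ∀ v : Fin G.nv, (MeasurableEquiv.piCongrLeft (fun _ => ℝ) finSumFinEquiv)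
      ((MeasurableEquiv.sumPiEquivProdPi (fun _ : Fin G.nv ⊕ Fin H.nv => ℝ)).symm z)
        (Fin.castAdd H.nv v) = z.1 v := by
    intro v
    rw [← finSumFinEquiv_apply_left, MeasurableEquiv.piCongrLeft_apply_apply]
    rfl
  have hr : ∀ v : Fin H.nv, (MeasurableEquiv.piCongrLeft (fun _ => ℝ) finSumFinEquiv)
      ((MeasurableEquiv.sumPiEquivProdPi (fun _ : Fin G.nv ⊕ Fin H.nv => ℝ)).symm z)
        (Fin.natAdd G.nv v) = z.2 v := by
    intro v
    rw [← finSumFinEquiv_apply_right, MeasurableEquiv.piCongrLeft_apply_apply]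
    rfl
  refine (Fin.prod_univ_add (M := ℝ) (a := G.ne) (b := H.ne) _).trans ?_
  congr 1
  · refine Finset.prod_congr rfl fun e _ => ?_
    simp only [MG.disj, Fin.addCases_left]
    rw [← hl, ← hl]
  · refine Finset.prod_congr rfl fun e _ => ?_
    simp only [MG.disj, Fin.addCases_right]
    rw [← hr, ← hr]

/-- The empty multigraph. -/
def MG.nil : MG := ⟨0, 0, Fin.elim0, Fin.elim0, fun e => e.elim0⟩

theorem homDensity_nil (f : Kern) : homDensity MG.nil f = 1 := by
  unfold homDensity
  have : ∀ x : Fin MG.nil.nv → ℝ,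
      ∏ e : Fin MG.nil.ne, f (x (MG.nil.s e)) (x (MG.nil.t e)) = 1 :=
    fun x => Fin.prod_univ_zero _
  have h1 : IsProbabilityMeasure μ01 := ⟨by simp⟩
  simp [this]

/-- The submonoid of density vectors of simple graphs. -/
def densMonoid (k : ℕ) (f : Fin k → Kern) : Submonoid (Fin k → ℝ) where
  carrier := {v | ∃ G : MG, IsSimpleMG G ∧ v = fun j => homDensity G (f j)}
  one_mem' := ⟨MG.nil, fun e => e.elim0, by funext j; simp [homDensity_nil]⟩
  mul_mem' := by
    rintro _ _ ⟨G, hG, rfl⟩ ⟨H, hH, rfl⟩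
    exact ⟨G.disj H, disj_simple G H hG hH, by funext j; simp [homDensity_disj]⟩

/-- Lagrange interpolation. Pairwise non-weakly-equivalent graphons
can be interpolated at arbitrarily prescribed values by a linear combination of
simple-graph homomorphism densities. -/
theorem stmt2 (k : ℕ) (f : Fin k → Kern) (hf : ∀ j, IsGraphon (f j))
    (hsep : ∀ i j, i ≠ j →
      ∃ G : MG, IsSimpleMG G ∧ homDensity G (f i) ≠ homDensity G (f j))
    (a : Fin k → ℝ) :
    ∃ (m : ℕ) (H : Fin m → MG) (c : Fin m → ℝ),
      (∀ l, IsSimpleMG (H l)) ∧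
      ∀ j, ∑ l, c l * homDensity (H l) (f j) = a j := by
  set M := densMonoid k f with hM
  let A := Algebra.adjoin ℝ (M : Set (Fin k → ℝ))
  have hA : Subalgebra.toSubmodule A = Submodule.span ℝ (M : Set (Fin k → ℝ)) := by
    rw [Algebra.adjoin_eq_span, Submonoid.closure_eq]
  have key : ∀ i j, i ≠ j → ∃ v ∈ A, v i = 1 ∧ v j = 0 := by
    intro i j hij
    obtain ⟨G, hG, hne⟩ := hsep i j hij
    let w : Fin k → ℝ := fun l => homDensity G (f l)
    have hw : w ∈ A := Algebra.subset_adjoin ⟨G, hG, rfl⟩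
    have hne' : w i - w j ≠ 0 := sub_ne_zero.2 hne
    refine ⟨(w i - w j)⁻¹ • (w - algebraMap ℝ _ (w j)),
      A.smul_mem (A.sub_mem hw (A.algebraMap_mem _)) _, ?_, ?_⟩
    · simp [hne']
    · simp
  have hsingle : ∀ i, (Pi.single i 1 : Fin k → ℝ) ∈ A := by
    intro i
    choose! v hvA hv1 hv0 using key i
    have : (Pi.single i 1 : Fin k → ℝ) = ∏ j ∈ Finset.univ.erase i, v j := by
      funext l
      rw [Finset.prod_apply]
      by_cases hl : l = i
      · subst hl
        rw [Pi.single_eq_same]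
        exact (Finset.prod_eq_one fun j hj => hv1 j (Finset.ne_of_mem_erase hj).symm).symm
      · rw [Pi.single_eq_of_ne hl]
        exact (Finset.prod_eq_zero (f := fun c => v c l) (Finset.mem_erase.2 ⟨hl, Finset.mem_univ l⟩)
          (hv0 l (Ne.symm hl))).symm
    rw [this]
    exact A.prod_mem fun j hj => hvA j (Finset.ne_of_mem_erase hj).symm
  have haA : a ∈ A := by
    have : a = ∑ i, a i • (Pi.single i 1 : Fin k → ℝ) := by
      funext l
      simp [Finset.sum_apply, Pi.single_apply]
    rw [this]
    exact A.sum_mem fun i _ => A.smul_mem (hsingle i) _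
  have hspan : a ∈ Submodule.span ℝ (M : Set (Fin k → ℝ)) := by
    rw [← hA]; exact haA
  obtain ⟨m, c, g, hcg⟩ := Submodule.mem_span_set'.1 hspan
  choose H hHs hHv using fun l => (g l).2
  refine ⟨m, H, c, hHs, fun j => ?_⟩
  rw [← hcg, Finset.sum_apply]
  refine Finset.sum_congr rfl fun l _ => ?_
  rw [Pi.smul_apply, hHv l, smul_eq_mul]
end

section
/- Fix n ≥ 0 and constants a_H indexed by the isomorphism classes H of multigraphs with at most n edges and no isolated vertices, and let F(f) := Σ_H a_H·t(H,f) for f ∈ W. If F is continuous on W with respect to the cut norm, then F(f) = Σ_H a_H·t(H^{simp}, f) for all f ∈ W, where H^{simp} is the simple graph obtained from H by replacing each set of parallel edges between a pair of vertices by a single edge. -/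
open MeasureTheory Filter Set Topology
open scoped BigOperators Classical ENNReal

/-! ### Random 0/1-valued approximations of a graphon -/

noncomputable section

namespace RandApprox

instance : IsProbabilityMeasure μ01 := ⟨by simp [μ01]⟩

/-- The cell index of a point. -/
def cN (N : ℕ) (x : ℝ) : Fin (N + 1) := Fin.ofNat (N + 1) ⌊(N : ℝ) * x⌋₊

/-- Symmetric index of a pair of cells. -/
def idx {N : ℕ} (a b : Fin (N + 1)) : Fin (N + 1) × Fin (N + 1) := (min a b, max a b)

lemma idx_symm {N : ℕ} (a b : Fin (N + 1)) : idx a b = idx b a := by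
  simp [idx, min_comm, max_comm]

lemma idx_inj {N : ℕ} {a b c d : Fin (N + 1)} (h : idx a b = idx c d) :
    (a = c ∧ b = d) ∨ (a = d ∧ b = c) := by
  simp only [idx, Prod.mk.injEq] at h
  obtain ⟨h1, h2⟩ := h
  rcases le_total a b with h3 | h3 <;> rcases le_total c d with h4 | h4 <;>
    simp_all

/-- The random 0/1-valued graphon. -/
def gN (f : Kern) (N : ℕ) (ω : Fin (N + 1) × Fin (N + 1) → ℝ) : Kern := fun x y =>
  if ω (idx (cN N x) (cN N y)) < f x y then 1 else 0

/-- The random source. -/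
abbrev PN (N : ℕ) : Measure (Fin (N + 1) × Fin (N + 1) → ℝ) := Measure.pi fun _ => μ01

lemma measurable_cN (N : ℕ) : Measurable (cN N) := by
  unfold cN
  have h : Measurable (fun k : ℕ => Fin.ofNat (N + 1) k) := measurable_of_countable _
  exact h.comp (Nat.measurable_floor.comp (measurable_const.mul measurable_id))

lemma measurable_gN {f : Kern} (hf : IsGraphon f) (N : ℕ) {Z : Type*} [MeasurableSpace Z]
    {w : Z → Fin (N + 1) × Fin (N + 1) → ℝ} {u v : Z → ℝ} (hw : Measurable w)
    (hu : Measurable u) (hv : Measurable v) :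
    Measurable (fun z => gN f N (w z) (u z) (v z)) := by
  unfold gN
  refine Measurable.ite (measurableSet_lt ?_ ?_) measurable_const measurable_const
  · have h1 : Measurable (fun p : (Fin (N + 1) × Fin (N + 1) → ℝ) × (Fin (N + 1) × Fin (N + 1)) =>
        p.1 p.2) := measurable_from_prod_countable_left (fun i => measurable_pi_apply i)
    have h2 : Measurable (fun p : Fin (N + 1) × Fin (N + 1) => idx p.1 p.2) :=
      measurable_of_countable _
    exact h1.comp (hw.prodMk (h2.comp
      (((measurable_cN N).comp hu).prodMk ((measurable_cN N).comp hv))))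
  · exact hf.1.1.comp (hu.prodMk hv)

lemma measurable_f {f : Kern} (hf : IsGraphon f) {Z : Type*} [MeasurableSpace Z]
    {u v : Z → ℝ} (hu : Measurable u) (hv : Measurable v) :
    Measurable (fun z => f (u z) (v z)) := hf.1.1.comp (hu.prodMk hv)

lemma gN_zero_one (f : Kern) (N : ℕ) (ω) (x y : ℝ) : gN f N ω x y = 0 ∨ gN f N ω x y = 1 := by
  unfold gN; split_ifs <;> simp

lemma gN_mem (f : Kern) (N : ℕ) (ω) (x y : ℝ) : gN f N ω x y ∈ Set.Icc (0:ℝ) 1 := by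
  rcases gN_zero_one f N ω x y with h | h <;> rw [h] <;> simp

lemma gN_graphon {f : Kern} (hf : IsGraphon f) (N : ℕ) (ω) : IsGraphon (gN f N ω) := by
  refine ⟨⟨?_, ?_⟩, gN_mem f N ω⟩
  · exact measurable_gN hf N measurable_const measurable_fst measurable_snd
  · intro x y
    simp only [gN, idx_symm (cN N x), hf.1.2 x y]

lemma integral_ind {p : ℝ} (hp : p ∈ Set.Icc (0:ℝ) 1) :
    ∫ u, (if u < p then (1:ℝ) else 0) ∂μ01 = p := by
  have : (fun u : ℝ => if u < p then (1:ℝ) else 0) = (Set.Iio p).indicator (fun _ => 1) := by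
    ext u; simp [Set.indicator]
  rw [this, integral_indicator measurableSet_Iio]
  have h2 : Set.Iio p ∩ Set.Icc 0 1 = Set.Ico 0 p := by
    ext u; simp only [Set.mem_inter_iff, Set.mem_Iio, Set.mem_Icc, Set.mem_Ico]
    constructor
    · rintro ⟨h, h1, h2⟩; exact ⟨h1, h⟩
    · rintro ⟨h, h1⟩; exact ⟨h1, h, h1.le.trans hp.2⟩
  simp [μ01, Measure.restrict_restrict, h2, hp.1]

lemma integral_prod_coord {ι Q : Type*} [Fintype ι] (E : Finset Q) (s : Q → ι)
    (hs : Set.InjOn s E) (ψ : Q → ℝ → ℝ) :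
    ∫ ω : ι → ℝ, ∏ q ∈ E, ψ q (ω (s q)) ∂(Measure.pi fun _ => μ01)
      = ∏ q ∈ E, ∫ u, ψ q u ∂μ01 := by
  have h1 : ∀ ω : ι → ℝ, ∏ q ∈ E, ψ q (ω (s q))
      = ∏ i, (fun u => ∏ q ∈ E with s q = i, ψ q u) (ω i) := by
    intro ω
    rw [← Finset.prod_fiberwise E s]
    refine Finset.prod_congr rfl fun i _ => Finset.prod_congr rfl fun q hq => ?_
    rw [(Finset.mem_filter.1 hq).2]
  simp_rw [h1]
  rw [integral_fintype_prod_eq_prod (f := fun i u => ∏ q ∈ E with s q = i, ψ q u),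
    ← Finset.prod_fiberwise E s]
  refine Finset.prod_congr rfl fun i _ => ?_
  have hc : (E.filter (fun q => s q = i)).card ≤ 1 := by
    rw [Finset.card_le_one]
    intro a ha b hb
    simp only [Finset.mem_filter] at ha hb
    exact hs ha.1 hb.1 (ha.2.trans hb.2.symm)
  rcases Nat.le_one_iff_eq_zero_or_eq_one.1 hc with h | h
  · simp [Finset.card_eq_zero.1 h]
  · obtain ⟨q, h⟩ := Finset.card_eq_one.1 h
    simp [h]

lemma cN_eventually_ne {x y : ℝ} (hx : x ∈ Set.Icc (0:ℝ) 1) (hy : y ∈ Set.Icc (0:ℝ) 1)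
    (hxy : x ≠ y) : ∀ᶠ N : ℕ in atTop, cN N x ≠ cN N y := by
  wlog h : x < y generalizing x y
  · exact (this hy hx hxy.symm (lt_of_le_of_ne (not_lt.1 h) hxy.symm)).mono fun N h => h.symm
  obtain ⟨M, hM⟩ := exists_nat_gt (1 / (y - x))
  filter_upwards [eventually_ge_atTop M] with N hN heq
  have hpos : 0 < y - x := sub_pos.2 h
  have hN' : 1 < (N:ℝ) * (y - x) := by
    rw [← div_lt_iff₀ hpos]; exact hM.trans_le (by exact_mod_cast hN)
  have hb : ∀ z ∈ Set.Icc (0:ℝ) 1, ⌊(N:ℝ) * z⌋₊ < N + 1 := by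
    intro z hz
    rw [Nat.lt_succ_iff]
    refine Nat.floor_le_of_le ?_
    nlinarith [hz.1, hz.2, Nat.cast_nonneg (α := ℝ) N]
  have := congrArg Fin.val heq
  simp only [cN, Fin.ofNat, Nat.mod_eq_of_lt (hb x hx), Nat.mod_eq_of_lt (hb y hy)] at this
  have h1 := Nat.lt_floor_add_one ((N:ℝ) * y)
  have h2 := Nat.lt_floor_add_one ((N:ℝ) * x)
  have h3 := Nat.floor_le (mul_nonneg (Nat.cast_nonneg (α := ℝ) N) hx.1)
  have h4 := Nat.floor_le (mul_nonneg (Nat.cast_nonneg (α := ℝ) N) hy.1)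
  rw [this] at h3
  linarith

lemma factor_bound {f : Kern} (hf : IsGraphon f) {β : ℝ} (hβ : β = 0 ∨ β = 1) (N ω x y) :
    |gN f N ω x y - β * f x y| ≤ 1 := by
  have h1 := gN_mem f N ω x y
  have h2 := hf.2 x y
  rw [abs_le]
  rcases hβ with rfl | rfl <;> constructor <;> linarith [h1.1, h1.2, h2.1, h2.2]

lemma prod_bound {Q : Type*} (E : Finset Q) (u : Q → ℝ) (h : ∀ q ∈ E, |u q| ≤ 1) :
    |∏ q ∈ E, u q| ≤ 1 := by
  rw [Finset.abs_prod]
  exact Finset.prod_le_one (fun _ _ => abs_nonneg _) h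

/-- Main averaging lemma. -/
lemma tendsto_avg {f : Kern} (hf : IsGraphon f) {β : ℝ} (hβ : β = 0 ∨ β = 1)
    {X : Type*} [MeasurableSpace X] (P : Measure X) [IsProbabilityMeasure P] {m : ℕ}
    (v : Fin m → X → ℝ) (hv : ∀ i, Measurable (v i))
    (hmem : ∀ᵐ x ∂P, ∀ i, v i x ∈ Set.Icc (0:ℝ) 1)
    (hne : ∀ᵐ x ∂P, ∀ i j, i ≠ j → v i x ≠ v j x)
    (E : Finset (Fin m × Fin m)) (hE : ∀ q ∈ E, q.1 < q.2) :
    Tendsto (fun N : ℕ => ∫ ω, ∫ x, ∏ q ∈ E,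
        (gN f N ω (v q.1 x) (v q.2 x) - β * f (v q.1 x) (v q.2 x)) ∂P ∂(PN N)) atTop
      (𝓝 (∫ x, ∏ q ∈ E, ((1 - β) * f (v q.1 x) (v q.2 x)) ∂P)) := by
  have hmeas : ∀ N : ℕ, Measurable (fun p : (Fin (N + 1) × Fin (N + 1) → ℝ) × X =>
      ∏ q ∈ E, (gN f N p.1 (v q.1 p.2) (v q.2 p.2) - β * f (v q.1 p.2) (v q.2 p.2))) := by
    intro N
    refine Finset.measurable_prod _ fun q _ => ?_
    exact (measurable_gN hf N measurable_fst ((hv _).comp measurable_snd)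
      ((hv _).comp measurable_snd)).sub (measurable_const.mul
        (measurable_f hf ((hv _).comp measurable_snd) ((hv _).comp measurable_snd)))
  have hbd : ∀ (N : ℕ) (ω) (x), |∏ q ∈ E,
      (gN f N ω (v q.1 x) (v q.2 x) - β * f (v q.1 x) (v q.2 x))| ≤ 1 := fun N ω x =>
    prod_bound _ _ fun q _ => factor_bound hf hβ _ _ _ _
  have hint : ∀ N : ℕ, Integrable (fun p : (Fin (N + 1) × Fin (N + 1) → ℝ) × X =>
      ∏ q ∈ E, (gN f N p.1 (v q.1 p.2) (v q.2 p.2) - β * f (v q.1 p.2) (v q.2 p.2)))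
      ((PN N).prod P) := fun N =>
    Integrable.of_bound (hmeas N).aestronglyMeasurable 1 (ae_of_all _ fun p => hbd N p.1 p.2)
  have hswap : ∀ N : ℕ, ∫ ω, ∫ x, ∏ q ∈ E,
        (gN f N ω (v q.1 x) (v q.2 x) - β * f (v q.1 x) (v q.2 x)) ∂P ∂(PN N)
      = ∫ x, ∫ ω, ∏ q ∈ E,
        (gN f N ω (v q.1 x) (v q.2 x) - β * f (v q.1 x) (v q.2 x)) ∂(PN N) ∂P := fun N =>
    integral_integral_swap (f := fun ω x => ∏ q ∈ E,
        (gN f N ω (v q.1 x) (v q.2 x) - β * f (v q.1 x) (v q.2 x))) (hint N)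
  simp_rw [hswap]
  refine tendsto_integral_of_dominated_convergence (fun _ => 1) ?_ (integrable_const _) ?_ ?_
  · intro N
    exact (hint N).swap.aestronglyMeasurable.integral_prod_right'
  · intro N
    refine ae_of_all _ fun x => ?_
    have := norm_integral_le_of_norm_le_const (μ := PN N) (C := 1)
      (f := fun ω => ∏ q ∈ E, (gN f N ω (v q.1 x) (v q.2 x) - β * f (v q.1 x) (v q.2 x)))
      (ae_of_all _ fun ω => hbd N ω x)
    simpa using this
  · filter_upwards [hmem, hne] with x h1 h2
    have hev : ∀ᶠ N : ℕ in atTop, ∀ i j, i ≠ j → cN N (v i x) ≠ cN N (v j x) := by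
      rw [eventually_all]; intro i
      rw [eventually_all]; intro j
      by_cases hij : i = j
      · simp [hij]
      · exact (cN_eventually_ne (h1 i) (h1 j) (h2 i j hij)).mono fun N h _ => h
    refine tendsto_const_nhds.congr' ?_
    filter_upwards [hev] with N hN
    have hinj : ∀ i j, cN N (v i x) = cN N (v j x) → i = j := fun i j h => by
      by_contra hc; exact hN i j hc h
    have := integral_prod_coord E
      (fun q => idx (cN N (v q.1 x)) (cN N (v q.2 x))) ?_
      (fun q u => (if u < f (v q.1 x) (v q.2 x) then (1:ℝ) else 0) - β * f (v q.1 x) (v q.2 x))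
    · refine Eq.trans ?_ this.symm
      refine Finset.prod_congr rfl fun q _ => ?_
      rw [integral_sub, integral_ind (hf.2 _ _)]
      · simp; ring
      · refine Integrable.of_bound (C := 1) (Measurable.aestronglyMeasurable ?_) ?_
        · exact Measurable.ite measurableSet_Iio measurable_const measurable_const
        · exact ae_of_all _ fun u => by split_ifs <;> simp
      · exact integrable_const _
    · intro a ha b hb hab
      have ha' := hE a ha
      have hb' := hE b hb
      rcases idx_inj hab with ⟨h3, h4⟩ | ⟨h3, h4⟩
      · exact Prod.ext (hinj _ _ h3) (hinj _ _ h4)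
      · have h5 := hinj _ _ h3
        have h6 := hinj _ _ h4
        rw [h5, h6] at ha'
        exact absurd ha' (not_lt.2 hb'.le)

/-! ### Homomorphism densities -/

lemma pi_ae_mem (m : ℕ) : ∀ᵐ x ∂(Measure.pi fun _ : Fin m => μ01), ∀ i, x i ∈ Set.Icc (0:ℝ) 1 := by
  rw [← Measure.restrict_pi_pi]
  filter_upwards [ae_restrict_mem (MeasurableSet.univ_pi fun _ => measurableSet_Icc)] with x hx i
  exact hx i (Set.mem_univ i)

lemma pi_ae_ne (m : ℕ) : ∀ᵐ x ∂(Measure.pi fun _ : Fin m => μ01), ∀ i j, i ≠ j → x i ≠ x j := by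
  rw [← Measure.restrict_pi_pi]
  refine ae_restrict_of_ae ?_
  rw [ae_all_iff]; intro i
  rw [ae_all_iff]; intro j
  by_cases hij : i = j
  · simp [hij]
  have h := Measure.addHaar_submodule (volume : Measure (Fin m → ℝ))
    (LinearMap.ker ((LinearMap.proj i : (Fin m → ℝ) →ₗ[ℝ] ℝ) - LinearMap.proj j)) ?_
  · rw [← volume_pi]
    refine (measure_mono_null ?_ h)
    intro x hx
    simp only [Set.mem_compl_iff, Set.mem_ofPred_eq, not_forall, not_not] at hx
    obtain ⟨_, hx⟩ := hx
    simp [hx]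
  · intro htop
    have : (Pi.single i (1:ℝ) : Fin m → ℝ) ∈
      LinearMap.ker ((LinearMap.proj i : (Fin m → ℝ) →ₗ[ℝ] ℝ) - LinearMap.proj j) := by
      rw [htop]; trivial
    simp [Ne.symm hij] at this

/-- The pairs of adjacent vertices. -/
def simpE (G : MG) : Finset (Fin G.nv × Fin G.nv) :=
  Finset.univ.filter (fun q : Fin G.nv × Fin G.nv => q.1 < q.2 ∧ G.adj q.1 q.2)

lemma prod_eq_simp (G : MG) (f : Kern) (hf : IsGraphon f) (N ω) (x : Fin G.nv → ℝ) :
    ∏ e : Fin G.ne, gN f N ω (x (G.s e)) (x (G.t e))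
      = ∏ q ∈ simpE G, gN f N ω (x q.1) (x q.2) := by
  have hsymm := (gN_graphon hf N ω).1.2
  by_cases h : ∃ e : Fin G.ne, gN f N ω (x (G.s e)) (x (G.t e)) = 0
  · obtain ⟨e, he⟩ := h
    rw [Finset.prod_eq_zero (Finset.mem_univ e) he]
    rcases lt_or_gt_of_ne (G.noLoop e) with hl | hl
    · rw [Finset.prod_eq_zero (i := (G.s e, G.t e)) _ he]
      simp only [simpE, Finset.mem_filter, Finset.mem_univ, true_and]
      exact ⟨hl, e, Or.inl ⟨rfl, rfl⟩⟩
    · rw [hsymm] at he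
      rw [Finset.prod_eq_zero (i := (G.t e, G.s e)) _ he]
      simp only [simpE, Finset.mem_filter, Finset.mem_univ, true_and]
      exact ⟨hl, e, Or.inr ⟨rfl, rfl⟩⟩
  · push Not at h
    have h1 : ∀ e : Fin G.ne, gN f N ω (x (G.s e)) (x (G.t e)) = 1 := fun e =>
      (gN_zero_one f N ω _ _).resolve_left (h e)
    rw [Finset.prod_eq_one fun e _ => h1 e, Finset.prod_eq_one]
    intro q hq
    simp only [simpE, Finset.mem_filter, Finset.mem_univ, true_and] at hq
    obtain ⟨_, e, ⟨h2, h3⟩ | ⟨h2, h3⟩⟩ := hq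
    · rw [← h2, ← h3]; exact h1 e
    · rw [← h2, ← h3, hsymm]; exact h1 e

lemma tendsto_homDensity {f : Kern} (hf : IsGraphon f) (G : MG) :
    Tendsto (fun N : ℕ => ∫ ω, homDensity G (gN f N ω) ∂(PN N)) atTop
      (𝓝 (simpHomDensity G f)) := by
  have h := tendsto_avg hf (Or.inl rfl : (0:ℝ) = 0 ∨ _) (Measure.pi fun _ : Fin G.nv => μ01)
    (fun i x => x i) (fun i => measurable_pi_apply i) (pi_ae_mem _) (pi_ae_ne _) (simpE G)
    (fun q hq => (Finset.mem_filter.1 hq).2.1)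
  simp only [zero_mul, sub_zero, one_mul] at h
  unfold homDensity
  simp_rw [prod_eq_simp G f hf]
  exact h

lemma homDensity_bound {f : Kern} (hf : IsGraphon f) (G : MG) : |homDensity G f| ≤ 1 := by
  have := norm_integral_le_of_norm_le_const (μ := Measure.pi fun _ : Fin G.nv => μ01) (C := 1)
      (f := fun x => ∏ e : Fin G.ne, f (x (G.s e)) (x (G.t e)))
      (ae_of_all _ fun x => prod_bound _ _ fun e _ => by
        have := hf.2 (x (G.s e)) (x (G.t e))
        rw [abs_of_nonneg this.1]; exact this.2)
  simpa [homDensity] using this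

lemma homDensity_integrable {f : Kern} (hf : IsGraphon f) (G : MG) (N : ℕ) :
    Integrable (fun ω => homDensity G (gN f N ω)) (PN N) := by
  refine Integrable.of_bound (C := 1) ?_ (ae_of_all _ fun ω => homDensity_bound (gN_graphon hf N ω) G)
  have hm : Measurable (fun p : (Fin (N + 1) × Fin (N + 1) → ℝ) × (Fin G.nv → ℝ) =>
      ∏ e : Fin G.ne, gN f N p.1 (p.2 (G.s e)) (p.2 (G.t e))) :=
    Finset.measurable_prod _ fun e _ => measurable_gN hf N measurable_fst
      ((measurable_pi_apply _).comp measurable_snd) ((measurable_pi_apply _).comp measurable_snd)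
  exact (hm.stronglyMeasurable.integral_prod_right' (ν := Measure.pi fun _ : Fin G.nv => μ01)).aestronglyMeasurable

/-! ### Cut norm -/

lemma sq_integral_le {X : Type*} [MeasurableSpace X] (P : Measure X) [IsProbabilityMeasure P]
    {w φ : X → ℝ} (hw : Measurable w) (hφ : Measurable φ) (hw1 : ∀ x, |w x| ≤ 1)
    (hφ1 : ∀ x, |φ x| ≤ 1) : (∫ x, w x * φ x ∂P) ^ 2 ≤ ∫ x, φ x ^ 2 ∂P := by
  set c := ∫ x, w x * φ x ∂P with hc
  have hb : ∀ x, |w x * φ x| ≤ 1 := fun x => by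
    rw [abs_mul]; exact mul_le_one₀ (hw1 x) (abs_nonneg _) (hφ1 x)
  have i1 : Integrable (fun x => w x * φ x) P :=
    Integrable.of_bound (hw.mul hφ).aestronglyMeasurable 1 (ae_of_all _ hb)
  have i2 : Integrable (fun x => (w x * φ x) ^ 2) P :=
    Integrable.of_bound ((hw.mul hφ).pow_const 2).aestronglyMeasurable 1 (ae_of_all _ fun x => by
      rw [Real.norm_eq_abs, abs_pow]; exact pow_le_one₀ (abs_nonneg _) (hb x))
  have i3 : Integrable (fun x => φ x ^ 2) P :=
    Integrable.of_bound (hφ.pow_const 2).aestronglyMeasurable 1 (ae_of_all _ fun x => by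
      rw [Real.norm_eq_abs, abs_pow]; exact pow_le_one₀ (abs_nonneg _) (hφ1 x))
  have h0 : 0 ≤ ∫ x, ((w x * φ x) ^ 2 - 2 * c * (w x * φ x) + c ^ 2) ∂P :=
    integral_nonneg fun x => by
      have := sq_nonneg (w x * φ x - c)
      simp only [Pi.zero_apply]; nlinarith
  have i4 : Integrable (fun x => (w x * φ x) ^ 2 - 2 * c * (w x * φ x)) P :=
    i2.sub (i1.const_mul _)
  rw [integral_add i4 (integrable_const _), integral_sub i2 (i1.const_mul _), integral_const_mul, ← hc] at h0
  simp only [integral_const, probReal_univ, one_smul] at h0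
  have h1 : ∫ x, (w x * φ x) ^ 2 ∂P ≤ ∫ x, φ x ^ 2 ∂P := by
    refine integral_mono i2 i3 fun x => ?_
    have := hw1 x
    simp only [mul_pow]
    have h3 : w x ^ 2 ≤ 1 := by rw [← sq_abs]; exact pow_le_one₀ (abs_nonneg _) this
    nlinarith [sq_nonneg (φ x)]
  nlinarith

/-- Four-cycle density. -/
def D4 (h : Kern) : ℝ :=
  ∫ p : (ℝ × ℝ) × (ℝ × ℝ), h p.2.1 p.1.1 * h p.2.1 p.1.2 * (h p.2.2 p.1.1 * h p.2.2 p.1.2)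
    ∂((μ01.prod μ01).prod (μ01.prod μ01))

/-- Indicator weight. -/
def ind (S : Set ℝ) (x : ℝ) : ℝ := S.indicator (fun _ => (1:ℝ)) x

lemma measurable_ind {S : Set ℝ} (hS : MeasurableSet S) : Measurable (ind S) :=
  measurable_const.indicator hS

lemma ind_bound (S : Set ℝ) (x : ℝ) : |ind S x| ≤ 1 := by
  unfold ind Set.indicator; split_ifs <;> simp

lemma setInt_eq {S : Set ℝ} (hS : MeasurableSet S) (hS1 : S ⊆ Set.Icc 0 1) (φ : ℝ → ℝ) :
    ∫ x in S, φ x = ∫ x, ind S x * φ x ∂μ01 := by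
  rw [← Measure.restrict_restrict_of_subset hS1, ← integral_indicator hS]
  refine integral_congr_ae (ae_of_all _ fun x => ?_)
  simp only [ind, Set.indicator]; split_ifs <;> simp

lemma abs_mul_le_one {a b : ℝ} (ha : |a| ≤ 1) (hb : |b| ≤ 1) : |a * b| ≤ 1 := by
  rw [abs_mul]; exact mul_le_one₀ ha (abs_nonneg _) hb

lemma abs_int_le_one {X : Type*} [MeasurableSpace X] (P : Measure X) [IsProbabilityMeasure P]
    {φ : X → ℝ} (h : ∀ x, |φ x| ≤ 1) : |∫ x, φ x ∂P| ≤ 1 := by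
  have := norm_integral_le_of_norm_le_const (μ := P) (C := 1) (f := φ) (ae_of_all _ h)
  simpa using this

lemma cut_pow_four {h : Kern} (hm : Measurable (Function.uncurry h)) (hb : ∀ x y, |h x y| ≤ 1)
    {S T : Set ℝ} (hS : MeasurableSet S) (hT : MeasurableSet T)
    (hS1 : S ⊆ Set.Icc 0 1) (hT1 : T ⊆ Set.Icc 0 1) :
    (∫ x in S, ∫ y in T, h x y) ^ 4 ≤ D4 h := by
  have hmc : ∀ {Z : Type} [MeasurableSpace Z] {u v : Z → ℝ}, Measurable u → Measurable v →
      Measurable (fun z => h (u z) (v z)) := fun hu hv => hm.comp (hu.prodMk hv)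
  simp_rw [setInt_eq hT hT1]
  rw [setInt_eq hS hS1]
  set φ : ℝ → ℝ := fun x => ∫ y, ind T y * h x y ∂μ01 with hφ
  have hφm : Measurable φ := by
    have : Measurable (fun p : ℝ × ℝ => ind T p.2 * h p.1 p.2) :=
      ((measurable_ind hT).comp measurable_snd).mul (hmc measurable_fst measurable_snd)
    exact (this.stronglyMeasurable.integral_prod_right' (ν := μ01)).measurable
  have hφb : ∀ x, |φ x| ≤ 1 := fun x =>
    abs_int_le_one _ fun y => abs_mul_le_one (ind_bound _ _) (hb _ _)
  set K : ℝ × ℝ → ℝ := fun z => ∫ x, h x z.1 * h x z.2 ∂μ01 with hK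
  have hKm : Measurable K := by
    have : Measurable (fun p : (ℝ × ℝ) × ℝ => h p.2 p.1.1 * h p.2 p.1.2) :=
      (hmc measurable_snd measurable_fst.fst).mul (hmc measurable_snd measurable_fst.snd)
    exact (this.stronglyMeasurable.integral_prod_right' (ν := μ01)).measurable
  have hKb : ∀ z, |K z| ≤ 1 := fun z =>
    abs_int_le_one _ fun x => abs_mul_le_one (hb _ _) (hb _ _)
  have s1 := sq_integral_le μ01 (measurable_ind hS) hφm (ind_bound S) hφb
  have e1 : ∫ x, φ x ^ 2 ∂μ01 = ∫ z, (ind T z.1 * ind T z.2) * K z ∂(μ01.prod μ01) := by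
    have : ∀ x, φ x ^ 2 = ∫ z : ℝ × ℝ, (ind T z.1 * h x z.1) * (ind T z.2 * h x z.2)
        ∂(μ01.prod μ01) := fun x => by
      rw [integral_prod_mul (fun y => ind T y * h x y) (fun y => ind T y * h x y), sq]
    simp_rw [this]
    rw [integral_integral_swap]
    · refine integral_congr_ae (ae_of_all _ fun z => ?_)
      simp only [hK]
      rw [← integral_const_mul]
      refine integral_congr_ae (ae_of_all _ fun x => ?_)
      simp only; ring
    · refine Integrable.of_bound (C := 1) (Measurable.aestronglyMeasurable ?_)
        (ae_of_all _ fun p => ?_)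
      · exact (((measurable_ind hT).comp measurable_snd.fst).mul
          (hmc measurable_fst measurable_snd.fst)).mul
          (((measurable_ind hT).comp measurable_snd.snd).mul
          (hmc measurable_fst measurable_snd.snd))
      · exact abs_mul_le_one (abs_mul_le_one (ind_bound _ _) (hb _ _))
          (abs_mul_le_one (ind_bound _ _) (hb _ _))
  have s2 := sq_integral_le (μ01.prod μ01) (w := fun z => ind T z.1 * ind T z.2) (φ := K)
    (((measurable_ind hT).comp measurable_fst).mul ((measurable_ind hT).comp measurable_snd)) hKm
    (fun z => abs_mul_le_one (ind_bound _ _) (ind_bound _ _)) hKb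
  have e2 : ∫ z, K z ^ 2 ∂(μ01.prod μ01) = D4 h := by
    unfold D4
    symm
    rw [integral_prod]
    · refine integral_congr_ae (ae_of_all _ fun z => ?_)
      simp only
      rw [integral_prod_mul (fun x => h x z.1 * h x z.2) (fun x => h x z.1 * h x z.2), sq]
    · refine Integrable.of_bound (C := 1) (Measurable.aestronglyMeasurable ?_)
        (ae_of_all _ fun p => ?_)
      · exact ((hmc measurable_snd.fst measurable_fst.fst).mul
          (hmc measurable_snd.fst measurable_fst.snd)).mul
          ((hmc measurable_snd.snd measurable_fst.fst).mul
          (hmc measurable_snd.snd measurable_fst.snd))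
      · exact abs_mul_le_one (abs_mul_le_one (hb _ _) (hb _ _))
          (abs_mul_le_one (hb _ _) (hb _ _))
  rw [e1] at s1
  rw [e2] at s2
  calc _ = ((∫ x, ind S x * φ x ∂μ01) ^ 2) ^ 2 := by ring
    _ ≤ _ := (pow_le_pow_left₀ (sq_nonneg _) s1 2).trans s2

lemma D4_nonneg {h : Kern} (hm : Measurable (Function.uncurry h)) (hb : ∀ x y, |h x y| ≤ 1) :
    0 ≤ D4 h := by
  have := cut_pow_four hm hb (S := ∅) (T := ∅) MeasurableSet.empty MeasurableSet.empty
    (Set.empty_subset _) (Set.empty_subset _)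
  simpa using this

lemma cutNorm_lt {h : Kern} (hm : Measurable (Function.uncurry h)) (hb : ∀ x y, |h x y| ≤ 1)
    {δ : ℝ} (hδ : 0 < δ) (hD : D4 h < δ ^ 4) : cutNorm h < δ := by
  have h1 : cutNorm h ≤ √(√(D4 h)) := by
    refine csSup_le ⟨_, ∅, ∅, MeasurableSet.empty, MeasurableSet.empty,
      Set.empty_subset _, Set.empty_subset _, rfl⟩ ?_
    rintro r ⟨S, T, hS, hT, hS1, hT1, rfl⟩
    refine Real.le_sqrt_of_sq_le (Real.le_sqrt_of_sq_le ?_)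
    have := cut_pow_four hm hb hS hT hS1 hT1
    rw [← pow_mul]
    rw [Even.pow_abs (by decide)]
    exact this
  refine h1.trans_lt ?_
  rw [Real.sqrt_lt' hδ, Real.sqrt_lt' (by positivity), ← pow_mul]
  exact hD

lemma ae_prod_ne : ∀ᵐ q : ℝ × ℝ ∂(μ01.prod μ01), q.1 ≠ q.2 := by
  have hms : MeasurableSet {q : ℝ × ℝ | q.1 ≠ q.2} :=
    (measurableSet_eq_fun measurable_fst measurable_snd).compl
  rw [Measure.ae_prod_iff_ae_ae hms]
  refine ae_of_all _ fun x => ?_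
  have := measure_singleton (μ := μ01) x
  rw [ae_iff]
  convert this using 2
  ext y; simp [eq_comm]

lemma ae_mem01 : ∀ᵐ x ∂μ01, x ∈ Set.Icc (0:ℝ) 1 := ae_restrict_mem measurableSet_Icc

/-- The four vertices. -/
def v4 : Fin 4 → (ℝ × ℝ) × (ℝ × ℝ) → ℝ :=
  ![fun p => p.2.1, fun p => p.2.2, fun p => p.1.1, fun p => p.1.2]

lemma tendsto_D4 {f : Kern} (hf : IsGraphon f) :
    Tendsto (fun N : ℕ => ∫ ω, D4 (f - gN f N ω) ∂(PN N)) atTop (𝓝 0) := by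
  have qf : Measure.QuasiMeasurePreserving (Prod.fst : ℝ × ℝ → ℝ) (μ01.prod μ01) μ01 :=
    Measure.quasiMeasurePreserving_fst
  have qs : Measure.QuasiMeasurePreserving (Prod.snd : ℝ × ℝ → ℝ) (μ01.prod μ01) μ01 :=
    Measure.quasiMeasurePreserving_snd
  have Qf : Measure.QuasiMeasurePreserving (Prod.fst : (ℝ × ℝ) × (ℝ × ℝ) → ℝ × ℝ)
    ((μ01.prod μ01).prod (μ01.prod μ01)) (μ01.prod μ01) := Measure.quasiMeasurePreserving_fst
  have Qs : Measure.QuasiMeasurePreserving (Prod.snd : (ℝ × ℝ) × (ℝ × ℝ) → ℝ × ℝ)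
    ((μ01.prod μ01).prod (μ01.prod μ01)) (μ01.prod μ01) := Measure.quasiMeasurePreserving_snd
  have mf : MeasurePreserving (Prod.fst : ℝ × ℝ → ℝ) (μ01.prod μ01) μ01 := measurePreserving_fst
  have ms : MeasurePreserving (Prod.snd : ℝ × ℝ → ℝ) (μ01.prod μ01) μ01 := measurePreserving_snd
  have h := tendsto_avg hf (Or.inr rfl : (1:ℝ) = 0 ∨ _)
    ((μ01.prod μ01).prod (μ01.prod μ01)) v4 ?_ ?_ ?_
    {((0 : Fin 4), (2 : Fin 4)), (0, 3), (1, 2), (1, 3)} (by decide)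
  · have e0 : ∫ x, ∏ q ∈ ({((0 : Fin 4), (2 : Fin 4)), (0, 3), (1, 2), (1, 3)} : Finset _),
        ((1 - 1) * f (v4 q.1 x) (v4 q.2 x)) ∂((μ01.prod μ01).prod (μ01.prod μ01)) = 0 := by
      simp
    rw [e0] at h
    refine h.congr fun N => ?_
    refine integral_congr_ae (ae_of_all _ fun ω => ?_)
    unfold D4
    refine integral_congr_ae (ae_of_all _ fun p => ?_)
    simp only []
    rw [Finset.prod_insert (by decide), Finset.prod_insert (by decide),
      Finset.prod_insert (by decide), Finset.prod_singleton]
    simp only [v4, Pi.sub_apply, Matrix.cons_val, one_mul]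
    ring
  · intro i
    fin_cases i <;> simp [v4] <;> fun_prop
  · filter_upwards [Qf.ae (qf.ae ae_mem01), Qf.ae (qs.ae ae_mem01), Qs.ae (qf.ae ae_mem01),
      Qs.ae (qs.ae ae_mem01)] with p h1 h2 h3 h4 i
    fin_cases i
    · exact h3
    · exact h4
    · exact h1
    · exact h2
  · filter_upwards [Qf.ae ae_prod_ne, Qs.ae ae_prod_ne,
      (mf.prod mf).quasiMeasurePreserving.ae ae_prod_ne,
      (mf.prod ms).quasiMeasurePreserving.ae ae_prod_ne,
      (ms.prod mf).quasiMeasurePreserving.ae ae_prod_ne,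
      (ms.prod ms).quasiMeasurePreserving.ae ae_prod_ne] with p h1 h2 h3 h4 h5 h6 i j hij
    simp only [Prod.map] at h3 h4 h5 h6
    fin_cases i <;> fin_cases j <;> simp [v4] at hij ⊢ <;>
      first
        | assumption
        | (apply Ne.symm; assumption)

lemma diff_bound {f : Kern} (hf : IsGraphon f) (N ω) (x y : ℝ) :
    |(f - gN f N ω) x y| ≤ 1 := by
  have h1 := gN_mem f N ω x y
  have h2 := hf.2 x y
  simp only [Pi.sub_apply]
  rw [abs_le]
  constructor <;> linarith [h1.1, h1.2, h2.1, h2.2]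

lemma diff_meas {f : Kern} (hf : IsGraphon f) (N ω) :
    Measurable (Function.uncurry (f - gN f N ω)) :=
  hf.1.1.sub (gN_graphon hf N ω).1.1

lemma D4_integrable {f : Kern} (hf : IsGraphon f) (N : ℕ) :
    Integrable (fun ω => D4 (f - gN f N ω)) (PN N) := by
  refine Integrable.of_bound (C := 1) ?_ (ae_of_all _ fun ω => ?_)
  · have hd : ∀ {u v : (Fin (N + 1) × Fin (N + 1) → ℝ) × ((ℝ × ℝ) × (ℝ × ℝ)) → ℝ},
        Measurable u → Measurable v →
        Measurable (fun z => (f - gN f N z.1) (u z) (v z)) := fun hu hv =>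
      (measurable_f hf hu hv).sub (measurable_gN hf N measurable_fst hu hv)
    have hm : Measurable (fun z : (Fin (N + 1) × Fin (N + 1) → ℝ) × ((ℝ × ℝ) × (ℝ × ℝ)) =>
        (f - gN f N z.1) z.2.2.1 z.2.1.1 * (f - gN f N z.1) z.2.2.1 z.2.1.2 *
        ((f - gN f N z.1) z.2.2.2 z.2.1.1 * (f - gN f N z.1) z.2.2.2 z.2.1.2)) :=
      ((hd (by fun_prop) (by fun_prop)).mul (hd (by fun_prop) (by fun_prop))).mul
        ((hd (by fun_prop) (by fun_prop)).mul (hd (by fun_prop) (by fun_prop)))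
    exact (hm.stronglyMeasurable.integral_prod_right'
      (ν := (μ01.prod μ01).prod (μ01.prod μ01))).aestronglyMeasurable
  · have hb := diff_bound hf N ω
    exact abs_int_le_one _ fun p => abs_mul_le_one (abs_mul_le_one (hb _ _) (hb _ _))
          (abs_mul_le_one (hb _ _) (hb _ _))

/-! ### Finiteness -/

lemma finite_MG (A B : ℕ) : {G : MG | G.nv ≤ A ∧ G.ne ≤ B}.Finite := by
  let I := Σ i : Fin (A + 1), Σ j : Fin (B + 1),
    {st : (Fin j → Fin i) × (Fin j → Fin i) // ∀ e, st.1 e ≠ st.2 e}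
  let φ : I → MG := fun p => ⟨p.1, p.2.1, p.2.2.1.1, p.2.2.1.2, p.2.2.2⟩
  refine (Set.finite_range φ).subset ?_
  rintro ⟨nv, ne, s, t, h⟩ ⟨h1, h2⟩
  exact ⟨⟨⟨nv, Nat.lt_succ_of_le h1⟩, ⟨ne, Nat.lt_succ_of_le h2⟩, ⟨(s, t), h⟩⟩, rfl⟩

lemma nv_le {G : MG} (h : NoIsolated G) : G.nv ≤ 2 * G.ne := by
  have hs : Function.Surjective (fun p : Fin 2 × Fin G.ne => if p.1 = 0 then G.s p.2 else G.t p.2) := by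
    intro v
    obtain ⟨e, he | he⟩ := h v
    · exact ⟨(0, e), by simp [he]⟩
    · exact ⟨(1, e), by simp [he]⟩
  simpa using Fintype.card_le_of_surjective _ hs

lemma finite_supp {n : ℕ} {a : MG → ℝ} (ha : GoodCoeffs n a) : (Function.support a).Finite := by
  refine (finite_MG (2 * n) n).subset ?_
  intro G hG
  by_contra hc
  refine hG (ha.2 G fun ⟨h1, h2⟩ => hc ⟨?_, h1⟩)
  have := nv_le h2
  omega

end RandApprox

end

open RandApprox

theorem stmt4 (n : ℕ) (a : MG → ℝ) (ha : GoodCoeffs n a)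
    (hcont : CutContOn (fun f => ∑ᶠ G : MG, a G * homDensity G f)) :
    ∀ f ∈ Graphons,
      (∑ᶠ G : MG, a G * homDensity G f) = ∑ᶠ G : MG, a G * simpHomDensity G f := by
  intro f hf
  have hf' : IsGraphon f := hf
  have hfs : ∀ φ : MG → ℝ, (∑ᶠ G : MG, a G * φ G)
      = ∑ G ∈ (finite_supp ha).toFinset, a G * φ G := fun φ =>
    finsum_eq_sum_of_support_subset _ (by
      intro G hG
      simp only [Set.Finite.coe_toFinset, Function.mem_support] at hG ⊢
      exact left_ne_zero_of_mul hG)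
  have hcont' := hcont f hf
  simp only [hfs] at hcont' ⊢
  set R := (finite_supp ha).toFinset with hR
  set F : Kern → ℝ := fun g => ∑ G ∈ R, a G * homDensity G g with hF
  set M : ℝ := ∑ G ∈ R, |a G| with hM
  have hM0 : 0 ≤ M := Finset.sum_nonneg fun _ _ => abs_nonneg _
  have hFb : ∀ g, IsGraphon g → |F g| ≤ M := fun g hg => by
    refine (Finset.abs_sum_le_sum_abs _ _).trans (Finset.sum_le_sum fun G _ => ?_)
    rw [abs_mul]
    exact mul_le_of_le_one_right (abs_nonneg _) (homDensity_bound hg G)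
  have hFi : ∀ N, Integrable (fun ω => F (gN f N ω)) (PN N) := fun N =>
    integrable_finsetSum _ fun G _ => (homDensity_integrable hf' G N).const_mul _
  have lim1 : Tendsto (fun N : ℕ => ∫ ω, F (gN f N ω) ∂(PN N)) atTop
      (𝓝 (∑ G ∈ R, a G * simpHomDensity G f)) := by
    have : ∀ N : ℕ, ∫ ω, F (gN f N ω) ∂(PN N)
        = ∑ G ∈ R, a G * ∫ ω, homDensity G (gN f N ω) ∂(PN N) := fun N => by
      simp only [hF]
      rw [integral_finsetSum _ fun G _ => (homDensity_integrable hf' G N).const_mul _]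
      simp only [integral_const_mul]
    simp_rw [this]
    exact tendsto_finsetSum _ fun G _ => (tendsto_homDensity hf' G).const_mul _
  have lim2 : Tendsto (fun N : ℕ => ∫ ω, F (gN f N ω) ∂(PN N)) atTop (𝓝 (F f)) := by
    rw [Metric.tendsto_atTop']
    intro ε hε
    obtain ⟨δ, hδ, hc⟩ := hcont' (ε / 2) (half_pos hε)
    have hpt : ∀ N ω, |F f - F (gN f N ω)| ≤ ε / 2 + 2 * M / δ ^ 4 * D4 (f - gN f N ω) := by
      intro N ω
      have hD0 := D4_nonneg (diff_meas hf' N ω) (diff_bound hf' N ω)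
      have hδ4 : 0 < δ ^ 4 := by positivity
      by_cases hD : D4 (f - gN f N ω) < δ ^ 4
      · have := hc (gN f N ω) (gN_graphon hf' N ω)
          (cutNorm_lt (diff_meas hf' N ω) (diff_bound hf' N ω) hδ hD)
        have h2 : 0 ≤ 2 * M / δ ^ 4 * D4 (f - gN f N ω) := by positivity
        linarith
      · have h1 := abs_sub (F f) (F (gN f N ω))
        have h2 := hFb f hf'
        have h3 := hFb _ (gN_graphon hf' N ω)
        have h4 : 2 * M ≤ 2 * M / δ ^ 4 * D4 (f - gN f N ω) := by
          rw [div_mul_eq_mul_div, le_div_iff₀ hδ4]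
          exact mul_le_mul_of_nonneg_left (not_lt.1 hD) (by positivity)
        linarith
    have hbd : ∀ N : ℕ, |∫ ω, F (gN f N ω) ∂(PN N) - F f|
        ≤ ε / 2 + 2 * M / δ ^ 4 * ∫ ω, D4 (f - gN f N ω) ∂(PN N) := by
      intro N
      have i1 : Integrable (fun ω => F f - F (gN f N ω)) (PN N) := (integrable_const _).sub (hFi N)
      have e1 : ∫ ω, F (gN f N ω) ∂(PN N) - F f = - ∫ ω, (F f - F (gN f N ω)) ∂(PN N) := by
        rw [integral_sub (integrable_const _) (hFi N)]; simp
      rw [e1, abs_neg]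
      refine abs_integral_le_integral_abs.trans ?_
      refine (integral_mono i1.abs ((integrable_const _).add ((D4_integrable hf' N).const_mul _))
        (hpt N)).trans ?_
      simp only [Pi.add_apply]
      rw [integral_add (integrable_const _) ((D4_integrable hf' N).const_mul _),
        integral_const_mul]
      simp
    have hlim : Tendsto (fun N : ℕ => ε / 2 + 2 * M / δ ^ 4 * ∫ ω, D4 (f - gN f N ω) ∂(PN N))
        atTop (𝓝 (ε / 2)) := by
      simpa using ((tendsto_D4 hf').const_mul (2 * M / δ ^ 4)).const_add (ε / 2)
    obtain ⟨N0, hN0⟩ := eventually_atTop.1 (hlim.eventually_lt_const (half_lt_self hε))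
    refine ⟨N0, fun N hN => ?_⟩
    rw [Real.dist_eq]
    exact (hbd N).trans_lt (hN0 N hN.le)
  exact tendsto_nhds_unique lim2 lim1
end
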